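/- arXiv:0812.1280 — 9 statements merged into one kernel-verified Lean document; each statement's English description precedes it below -/
import Mathlib

section
/- Let P be a poset whose order is the intersection of finitely many scattered linear orders; that is, there exist n : ℕ and linear orders r 1, …, r n on the underlying set of P, none of which admits an order embedding of ℚ, such that for all a, b one has a ≤ b ↔ (for every i, r i a b). Then there is no map f : List Bool → P such that for all l, l' : List Bool, l is a prefix of l' ↔ f l ≤ f l' (i.e., the binary tree T₂ does not embed into P), and likewise there is no map g : List Bool → P such that l is a prefix of l' ↔ g l' ≤ g l (the dual of T₂ does not embed into P). -/
/-- A relation on `α` is scattered when there is no order embedding of `ℚ` into it. -/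
def NoRatEmbedRel {α : Type*} (r : α → α → Prop) : Prop :=
  ¬ ∃ f : ℚ → α, ∀ q q' : ℚ, q ≤ q' ↔ r (f q) (f q')

theorem List.prefix_or_prefix_or_exists_ne {β : Type*} (w v : List β) :
    w <+: v ∨ v <+: w ∨ ∃ c a b u t, a ≠ b ∧ w = c ++ a :: u ∧ v = c ++ b :: t := by
  induction w generalizing v with
  | nil => exact Or.inl List.nil_prefix
  | cons a w ih =>
    cases v with
    | nil => exact Or.inr (Or.inl List.nil_prefix)
    | cons b v =>
      by_cases hab : a = b
      · subst hab
        rcases ih v with h | h | ⟨c, x, y, u, t, hxy, rfl, rfl⟩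
        · exact Or.inl (by simpa using h)
        · exact Or.inr (Or.inl (by simpa using h))
        · exact Or.inr (Or.inr ⟨a :: c, x, y, u, t, hxy, rfl, rfl⟩)
      · exact Or.inr (Or.inr ⟨[], a, b, w, v, hab, rfl, rfl⟩)

/-- A map from binary words that is strictly increasing for the in-order traversal
has a range in which `ℚ` embeds. -/
theorem nonempty_rat_orderEmbedding_of_inorder {α : Type*} [LinearOrder α]
    (p : List Bool → α) (hfalse : ∀ c u, p (c ++ false :: u) < p c)
    (htrue : ∀ c u, p c < p (c ++ true :: u)) : Nonempty (ℚ ↪o α) := by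
  have between : ∀ w v, p w < p v → ∃ m, p w < p m ∧ p m < p v := by
    intro w v hwv
    rcases List.prefix_or_prefix_or_exists_ne w v with ⟨u, rfl⟩ | ⟨u, rfl⟩ | h
    · rcases u with _ | ⟨_ | _, u⟩
      · simp at hwv
      · exact absurd hwv (hfalse w u).not_gt
      · refine ⟨w ++ true :: u ++ [false], ?_, hfalse _ _⟩
        simpa using htrue w (u ++ [false])
    · rcases u with _ | ⟨_ | _, u⟩
      · simp at hwv
      · refine ⟨v ++ false :: u ++ [true], htrue _ _, ?_⟩
        simpa using hfalse v (u ++ [true])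
      · exact absurd hwv (htrue v u).not_gt
    · obtain ⟨c, a, b, u, t, hab, rfl, rfl⟩ := h
      rcases a with _ | _ <;> rcases b with _ | _
      · exact absurd rfl hab
      · exact ⟨c, hfalse _ _, htrue _ _⟩
      · exact absurd hwv ((hfalse c t).trans (htrue c u)).not_gt
      · exact absurd rfl hab
  have : DenselyOrdered (Set.range p) := by
    refine ⟨?_⟩
    rintro ⟨_, w, rfl⟩ ⟨_, v, rfl⟩ hwv
    obtain ⟨m, h₁, h₂⟩ := between w v hwv
    exact ⟨⟨p m, m, rfl⟩, h₁, h₂⟩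
  have : Nontrivial (Set.range p) :=
    ⟨⟨p [], [], rfl⟩, ⟨p [true], [true], rfl⟩, fun h =>
      (htrue [] []).ne (congrArg Subtype.val h)⟩
  obtain ⟨e⟩ := Order.embedding_from_countable_to_dense ℚ (Set.range p)
  exact ⟨e.trans (OrderEmbedding.subtype _)⟩

theorem List.prefix_foldl {β γ : Type*} (step : List β → γ → List β)
    (hstep : ∀ s b, s <+: step s b) (u : List γ) (s : List β) : s <+: u.foldl step s := by
  induction u generalizing s with
  | nil => exact List.prefix_rfl
  | cons b u ih => exact (hstep s b).trans (ih _)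

/-- In a scattered linear extension of the binary tree, every cone is cofinal in the
cone above some node. -/
theorem exists_forall_cone_cofinal {α : Type*} [LinearOrder α] (hα : IsEmpty (ℚ ↪o α))
    (f : List Bool → α) (hf : ∀ l l', l <+: l' → f l ≤ f l') :
    ∃ s, ∀ x y, s <+: x → s <+: y → ∃ z, x <+: z ∧ f y ≤ f z := by
  by_contra! H
  choose X Y hX hY hXY using H
  let step : List Bool → Bool → List Bool := fun s b => bif b then Y (Y s) else X s
  have hstep : ∀ s b, s <+: step s b := by
    rintro s (_ | _)
    · exact hX s
    · exact (hY s).trans (hY _)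
  let h : List Bool → List Bool := fun w => w.foldl step []
  have hh : ∀ c b u, step (h c) b <+: h (c ++ b :: u) := by
    intro c b u
    simpa [h] using List.prefix_foldl step hstep u (step (h c) b)
  refine hα.elim' (nonempty_rat_orderEmbedding_of_inorder (fun w => f (X (Y (h w)))) ?_ ?_).some
  · intro c u
    refine (hXY (h c) _ ?_).trans_le (hf _ _ (hX _))
    exact (hh c false u).trans ((hY _).trans (hX _))
  · intro c u
    refine (hXY (Y (h c)) _ List.prefix_rfl).trans_le (hf _ _ ?_)
    exact (hh c true u).trans ((hY _).trans (hX _))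

/-- `exists_forall_cone_cofinal` for an unbundled linear order, above a prescribed node. -/
theorem NoRatEmbedRel.exists_forall_cone_cofinal {α : Type*} {r : α → α → Prop}
    (hlin : IsLinearOrder α r) (hr : NoRatEmbedRel r)
    (f : List Bool → α) (hf : ∀ l l', l <+: l' → r (f l) (f l')) (s₀ : List Bool) :
    ∃ s, s₀ <+: s ∧ ∀ x y, s <+: x → s <+: y → ∃ z, x <+: z ∧ r (f y) (f z) := by
  classical
  let _ : LinearOrder α :=
    { le := r
      le_refl := hlin.refl
      le_trans := hlin.trans
      le_antisymm := hlin.antisymm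
      le_total := hlin.total
      toDecidableLE := Classical.decRel r }
  have hα : IsEmpty (ℚ ↪o α) := ⟨fun e => hr ⟨e, fun _ _ => e.le_iff_le.symm⟩⟩
  obtain ⟨s, hs⟩ := _root_.exists_forall_cone_cofinal hα (fun l => f (s₀ ++ l))
    fun l l' h => hf _ _ ((List.prefix_append_right_inj s₀).2 h)
  refine ⟨s₀ ++ s, List.prefix_append _ _, ?_⟩
  rintro _ _ ⟨x, rfl⟩ ⟨y, rfl⟩
  obtain ⟨z, hz, hyz⟩ := hs (s ++ x) (s ++ y) (List.prefix_append _ _) (List.prefix_append _ _)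
  refine ⟨s₀ ++ z, ?_, ?_⟩
  · simpa using hz
  · rw [← List.append_assoc] at hyz
    exact hyz

theorem prefix_ne_inter_scattered {α ι : Type*} [Finite ι] (r : ι → α → α → Prop)
    (hlin : ∀ i, IsLinearOrder α (r i)) (hscat : ∀ i, NoRatEmbedRel (r i)) :
    ¬ ∃ f : List Bool → α, ∀ l l' : List Bool, l <+: l' ↔ ∀ i, r i (f l) (f l') := by
  classical
  rintro ⟨f, hf⟩
  have := Fintype.ofFinite ι
  have hmono : ∀ i l l', l <+: l' → r i (f l) (f l') := fun i l l' h => (hf l l').1 h i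
  have cofinal : ∀ F : Finset ι, ∃ s, ∀ i ∈ F, ∀ x y, s <+: x → s <+: y →
      ∃ z, x <+: z ∧ r i (f y) (f z) := by
    intro F
    induction F using Finset.induction_on with
    | empty => exact ⟨[], by simp⟩
    | insert j F _ ih =>
      obtain ⟨s₀, hs₀⟩ := ih
      obtain ⟨s, hs, hcof⟩ := (hscat j).exists_forall_cone_cofinal (hlin j) f (hmono j) s₀
      refine ⟨s, fun i hi x y hx hy => ?_⟩
      rcases Finset.mem_insert.1 hi with rfl | hi
      · exact hcof x y hx hy
      · exact hs₀ i hi x y (hs.trans hx) (hs.trans hy)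
  obtain ⟨s, hs⟩ := cofinal Finset.univ
  have climb : ∀ F : Finset ι, ∃ z, s ++ [true] <+: z ∧
      ∀ i ∈ F, r i (f (s ++ [false])) (f z) := by
    intro F
    induction F using Finset.induction_on with
    | empty => exact ⟨s ++ [true], List.prefix_rfl, by simp⟩
    | insert j F _ ih =>
      obtain ⟨x, hx, hxF⟩ := ih
      obtain ⟨z, hz, hjz⟩ := hs j (Finset.mem_univ j) x (s ++ [false])
        ((List.prefix_append _ _).trans hx) (List.prefix_append _ _)
      refine ⟨z, hx.trans hz, fun i hi => ?_⟩
      rcases Finset.mem_insert.1 hi with rfl | hi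
      · exact hjz
      · exact (hlin i).trans _ _ _ (hxF i hi) (hmono i _ _ hz)
  obtain ⟨z, ⟨u, rfl⟩, hz⟩ := climb Finset.univ
  have := (hf _ _).2 fun i => hz i (Finset.mem_univ i)
  simp at this

theorem NoRatEmbedRel.swap {α : Type*} {r : α → α → Prop} (hr : NoRatEmbedRel r) :
    NoRatEmbedRel (fun a b => r b a) := by
  rintro ⟨f, hf⟩
  refine hr ⟨fun q => f (-q), fun q q' => ?_⟩
  rw [← neg_le_neg_iff]
  exact hf _ _

/-- If the order of a poset `P` is the intersection of finitely many scattered linear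
orders, then neither the binary tree `T₂` (that is, `List Bool` with the prefix order)
nor its dual embeds into `P`. -/
theorem binary_tree_not_embeddable_of_inter_scattered_linear_orders
    {α : Type*} [PartialOrder α] (n : ℕ) (r : Fin n → α → α → Prop)
    (hlin : ∀ i, IsLinearOrder α (r i))
    (hscat : ∀ i, NoRatEmbedRel (r i))
    (hint : ∀ a b : α, a ≤ b ↔ ∀ i, r i a b) :
    (¬ ∃ f : List Bool → α, ∀ l l' : List Bool, l <+: l' ↔ f l ≤ f l') ∧
    (¬ ∃ g : List Bool → α, ∀ l l' : List Bool, l <+: l' ↔ g l' ≤ g l) := by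
  constructor
  · rintro ⟨f, hf⟩
    exact prefix_ne_inter_scattered r hlin hscat ⟨f, fun l l' => (hf l l').trans (hint _ _)⟩
  · rintro ⟨g, hg⟩
    refine prefix_ne_inter_scattered (fun i a b => r i b a) (fun i => ?_)
      (fun i => (hscat i).swap) ⟨g, fun l l' => (hg l l').trans (hint _ _)⟩
    have := hlin i
    exact { refl := this.refl, trans := fun _ _ _ hab hbc => this.trans _ _ _ hbc hab,
            antisymm := fun _ _ hab hba => this.antisymm _ _ hba hab,
            total := fun _ _ => this.total _ _ }
end

section
/- Let P be a poset whose order is the intersection of finitely many scattered linear orders; that is, there exist n : ℕ and linear orders r 1, …, r n on the underlying set of P, none of which admits an order embedding of ℚ, such that for all a, b one has a ≤ b ↔ (for every i, r i a b). Then for every injective map e : ℚ → ℕ there is no map f : ℚ → P such that for all q, q' : ℚ, f q ≤ f q' ↔ (q ≤ q' and e q ≤ e q') (no copy of Ω(η) in P), and there is no map g : ℚ → P such that g q ≤ g q' ↔ (q' ≤ q and e q' ≤ e q) (no copy of the dual of Ω(η) in P). -/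
/-- A set of rationals is somewhere dense when it meets every subinterval of some nonempty open
interval. -/
def SomewhereDense (Y : Set ℚ) : Prop :=
  ∃ a b : ℚ, a < b ∧ ∀ c d, a ≤ c → c < d → d ≤ b → ∃ x ∈ Y, c < x ∧ x < d

namespace SomewhereDense

theorem mono {Y Z : Set ℚ} (h : SomewhereDense Y) (hYZ : Y ⊆ Z) : SomewhereDense Z := by
  obtain ⟨a, b, hab, h⟩ := h
  refine ⟨a, b, hab, fun c d h1 h2 h3 => ?_⟩
  obtain ⟨x, hx, hx'⟩ := h c d h1 h2 h3
  exact ⟨x, hYZ hx, hx'⟩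

theorem univ : SomewhereDense Set.univ :=
  ⟨0, 1, one_pos, fun _ _ _ hcd _ => (exists_between hcd).imp fun _ hx => ⟨trivial, hx⟩⟩

theorem of_union {Y Z : Set ℚ} (h : SomewhereDense (Y ∪ Z)) :
    SomewhereDense Y ∨ SomewhereDense Z := by
  obtain ⟨a, b, hab, h⟩ := h
  by_cases hY : ∀ c d, a ≤ c → c < d → d ≤ b → ∃ x ∈ Y, c < x ∧ x < d
  · exact Or.inl ⟨a, b, hab, hY⟩
  · push Not at hY
    obtain ⟨c, d, hac, hcd, hdb, hY⟩ := hY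
    refine Or.inr ⟨c, d, hcd, fun c' d' h1 h2 h3 => ?_⟩
    obtain ⟨x, hx | hx, hx1, hx2⟩ := h c' d' (hac.trans h1) h2 (h3.trans hdb)
    · exact absurd hx2 (not_lt.2 (h3.trans (hY x hx (h1.trans_lt hx1))))
    · exact ⟨x, hx, hx1, hx2⟩

theorem of_biUnion {ι : Type*} (s : Finset ι) {A : ι → Set ℚ}
    (h : SomewhereDense (⋃ i ∈ s, A i)) : ∃ i ∈ s, SomewhereDense (A i) := by
  classical
  induction s using Finset.induction_on with
  | empty =>
    obtain ⟨a, b, hab, h⟩ := h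
    obtain ⟨x, hx, -⟩ := h a b le_rfl hab le_rfl
    simp at hx
  | insert i s _ ih =>
    rw [Finset.set_biUnion_insert] at h
    rcases h.of_union with h | h
    · exact ⟨i, Finset.mem_insert_self i s, h⟩
    · obtain ⟨j, hj, h⟩ := ih h
      exact ⟨j, Finset.mem_insert_of_mem hj, h⟩

theorem infinite {Y : Set ℚ} (h : SomewhereDense Y) : Y.Infinite := by
  intro hfin
  have h' : SomewhereDense (⋃ i ∈ hfin.toFinset, {i}) := h.mono fun x hx => by simpa using hx
  obtain ⟨y, -, a, b, hab, h⟩ := of_biUnion _ h'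
  obtain ⟨_, rfl, hy1, hy2⟩ := h a b le_rfl hab le_rfl
  obtain ⟨_, rfl, -, hy3⟩ := h a _ le_rfl hy1 hy2.le
  exact lt_irrefl _ hy3

/-- A somewhere dense set contains a somewhere dense set without endpoints, in the strong sense
that all its final and initial segments are somewhere dense. -/
theorem exists_subset_forall_Ioi_Iio {Y : Set ℚ} (h : SomewhereDense Y) :
    ∃ Z ⊆ Y, SomewhereDense Z ∧
      ∀ b ∈ Z, SomewhereDense (Z ∩ Set.Ioi b) ∧ SomewhereDense (Z ∩ Set.Iio b) := by
  obtain ⟨a, c, hac, h⟩ := h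
  have key : ∀ u v, a ≤ u → u < v → v ≤ c →
      SomewhereDense ((Y ∩ Set.Ioo a c) ∩ Set.Ioo u v) := fun u v hu huv hv => by
    refine ⟨u, v, huv, fun c' d' h1 h2 h3 => ?_⟩
    obtain ⟨x, hx, hx1, hx2⟩ := h c' d' (hu.trans h1) h2 (h3.trans hv)
    exact ⟨x, ⟨⟨hx, (hu.trans h1).trans_lt hx1, hx2.trans_le (h3.trans hv)⟩,
      h1.trans_lt hx1, hx2.trans_le h3⟩, hx1, hx2⟩
  refine ⟨Y ∩ Set.Ioo a c, Set.inter_subset_left,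
    (key a c le_rfl hac le_rfl).mono Set.inter_subset_left, fun b hb => ⟨?_, ?_⟩⟩
  · exact (key b c hb.2.1.le hb.2.2 le_rfl).mono fun x hx => ⟨hx.1, hx.2.1⟩
  · exact (key a b le_rfl hb.2.1 hb.2.2.le).mono fun x hx => ⟨hx.1, hx.2.2⟩

end SomewhereDense

/-- A total relation compatible with a nonempty dense strict weak order `R` admits an
embedding of `ℚ`. -/
theorem exists_rat_embed_of_dense {β : Type*} {L R : β → β → Prop}
    (htotal : ∀ x y, L x y ∨ L y x) (hRL : ∀ x y, R x y → ¬ L y x)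
    (hneg : ∀ x y z, R x z → R x y ∨ R y z)
    (hdense : ∀ x y, R x y → ∃ b, R x b ∧ R b y) (hne : ∃ x y, R x y) :
    ∃ f : ℚ → β, ∀ q q' : ℚ, q ≤ q' ↔ L (f q) (f q') := by
  classical
  have hasymm : ∀ x y, R x y → ¬ R y x := fun x y h h' =>
    (htotal x y).elim (hRL y x h') (hRL x y h)
  let _ : Preorder β :=
    { le := fun x y => ¬ R y x
      le_refl := fun x h => hasymm x x h h
      le_trans := fun x y z hxy hyz h => (hneg z y x h).elim hyz hxy }
  have hlt : ∀ x y : β, x < y ↔ R x y := fun x y => by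
    rw [lt_iff_le_not_ge]
    exact ⟨fun h => not_not.1 h.2, fun h => ⟨hasymm x y h, not_not.2 h⟩⟩
  have : @Std.Total β (· ≤ ·) := ⟨fun x y => by
    by_cases h : R x y
    · exact Or.inl (hasymm x y h)
    · exact Or.inr h⟩
  let mk : β → Antisymmetrization β (· ≤ ·) := toAntisymmetrization (· ≤ ·)
  have hmk : ∀ x y, mk x < mk y ↔ R x y := fun x y =>
    toAntisymmetrization_lt_toAntisymmetrization_iff.trans (hlt x y)
  have hsurj : Function.Surjective mk := Quotient.mk_surjective
  have : DenselyOrdered (Antisymmetrization β (· ≤ ·)) := ⟨fun u v => by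
    obtain ⟨x, rfl⟩ := hsurj u
    obtain ⟨y, rfl⟩ := hsurj v
    intro h
    obtain ⟨b, h1, h2⟩ := hdense x y ((hmk x y).1 h)
    exact ⟨mk b, (hmk x b).2 h1, (hmk b y).2 h2⟩⟩
  have : Nontrivial (Antisymmetrization β (· ≤ ·)) := by
    obtain ⟨x, y, h⟩ := hne
    exact ⟨mk x, mk y, ((hmk x y).2 h).ne⟩
  obtain ⟨φ⟩ := Order.embedding_from_countable_to_dense ℚ (Antisymmetrization β (· ≤ ·))
  choose g hg using hsurj
  have hR : ∀ q q' : ℚ, q < q' → R (g (φ q)) (g (φ q')) := fun q q' h => by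
    rw [← hmk, hg, hg]
    exact φ.lt_iff_lt.2 h
  refine ⟨fun q => g (φ q), fun q q' => ⟨fun h => ?_, fun h => ?_⟩⟩
  · rcases h.eq_or_lt with rfl | h
    · exact (htotal _ _).elim id id
    · exact (htotal _ _).resolve_right (hRL _ _ (hR q q' h))
  · by_contra hlt'
    exact hRL _ _ (hR q' q (not_le.1 hlt')) h

/-- If a scattered linear order `L` extends `Ω(η)`, every somewhere dense set contains
a somewhere dense set none of whose principal initial segments for `L` is somewhere dense. -/
theorem exists_somewhereDense_initial_segments_not {e : ℚ → ℕ} (he : Function.Injective e)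
    {L : ℚ → ℚ → Prop} (hL : IsLinearOrder ℚ L) (hscat : NoRatEmbedRel L)
    (hext : ∀ q q', q ≤ q' → e q ≤ e q' → L q q') {Y₀ : Set ℚ} (hY₀ : SomewhereDense Y₀) :
    ∃ Y ⊆ Y₀, SomewhereDense Y ∧ ∀ b ∈ Y, ¬ SomewhereDense {q ∈ Y | L q b} := by
  by_contra! hcon
  have split : ∀ Y ⊆ Y₀, SomewhereDense Y → ∃ b ∈ Y,
      SomewhereDense {q ∈ Y | L q b} ∧ SomewhereDense {q ∈ Y | ¬ L q b} := by
    intro Y hY hYd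
    obtain ⟨Z, hZY, hZ, hseg⟩ := hYd.exists_subset_forall_Ioi_Iio
    obtain ⟨b, hb, hbL⟩ := hcon Z (hZY.trans hY) hZ
    refine ⟨b, hZY hb, hbL.mono fun q hq => ⟨hZY hq.1, hq.2⟩, ?_⟩
    have hsub : Z ∩ Set.Ioi b ⊆ {q ∈ Y | ¬ L q b} ∪ e ⁻¹' Set.Iic (e b) := by
      rintro q ⟨hq, hbq : b < q⟩
      by_cases hqe : e q ≤ e b
      · exact Or.inr hqe
      · exact Or.inl ⟨hZY hq, fun h =>
          hbq.ne (hL.antisymm _ _ (hext b q hbq.le (not_le.1 hqe).le) h)⟩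
    exact (((hseg b hb).1.mono hsub).of_union).resolve_right fun h =>
      h.infinite ((Set.finite_Iic (e b)).preimage he.injOn)
  refine hscat (exists_rat_embed_of_dense
    (R := fun x y => SomewhereDense {q ∈ Y₀ | ¬ L q x ∧ L q y}) hL.total ?_ ?_ ?_ ?_)
  · intro x y h hyx
    obtain ⟨q, hq⟩ := h.infinite.nonempty
    exact hq.2.1 (hL.trans _ _ _ hq.2.2 hyx)
  · intro x y z h
    refine (h.mono fun q hq => ?_).of_union
    by_cases hqy : L q y
    · exact Or.inl ⟨hq.1, hq.2.1, hqy⟩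
    · exact Or.inr ⟨hq.1, hqy, hq.2.2⟩
  · intro x y h
    obtain ⟨b, -, h1, h2⟩ := split _ (fun q hq => hq.1) h
    exact ⟨b, h1.mono fun q hq => ⟨hq.1.1, hq.1.2.1, hq.2⟩,
      h2.mono fun q hq => ⟨hq.1.1, hq.2, hq.1.2.2⟩⟩
  · obtain ⟨b, -, -, h⟩ := split Y₀ subset_rfl hY₀
    obtain ⟨c, -, hc, -⟩ := split _ (fun q hq => hq.1) h
    exact ⟨b, c, hc.mono fun q hq => ⟨hq.1.1, hq.1.2, hq.2⟩⟩

/-- `Ω(η)` is not the intersection of finitely many scattered linear orders. -/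
theorem omega_eta_ne_inter_scattered {ι : Type*} [Fintype ι] {e : ℚ → ℕ}
    (he : Function.Injective e) {L : ι → ℚ → ℚ → Prop} (hL : ∀ i, IsLinearOrder ℚ (L i))
    (hscat : ∀ i, NoRatEmbedRel (L i)) :
    ¬ ∀ q q', (∀ i, L i q q') ↔ (q ≤ q' ∧ e q ≤ e q') := by
  classical
  intro hint
  have hall : ∀ s : Finset ι, ∃ Y, SomewhereDense Y ∧
      ∀ i ∈ s, ∀ b ∈ Y, ¬ SomewhereDense {q ∈ Y | L i q b} := by
    intro s
    induction s using Finset.induction_on with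
    | empty => exact ⟨Set.univ, SomewhereDense.univ, by simp⟩
    | insert i s _ ih =>
      obtain ⟨Y, hY, hYs⟩ := ih
      obtain ⟨Z, hZY, hZ, hZi⟩ := exists_somewhereDense_initial_segments_not he (hL i) (hscat i)
        (fun q q' h h' => (hint q q').2 ⟨h, h'⟩ i) hY
      refine ⟨Z, hZ, fun j hj b hb => ?_⟩
      rcases Finset.mem_insert.1 hj with rfl | hj
      · exact hZi b hb
      · exact fun h => hYs j hj b (hZY hb) (h.mono fun q hq => ⟨hZY hq.1, hq.2⟩)
  obtain ⟨Y, hY, hYL⟩ := hall Finset.univ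
  obtain ⟨Z, hZY, hZ, hseg⟩ := hY.exists_subset_forall_Ioi_Iio
  obtain ⟨b, hb⟩ := hZ.infinite.nonempty
  have hsub : Z ∩ Set.Iio b ⊆ ⋃ i ∈ Finset.univ, {q ∈ Y | L i q b} := by
    rintro q ⟨hq, hqb : q < b⟩
    by_contra hno
    simp only [Finset.mem_univ, Set.iUnion_true, Set.mem_iUnion, not_exists] at hno
    have hbq : ∀ i, L i b q := fun i =>
      ((hL i).total b q).resolve_right fun h => hno i ⟨hZY hq, h⟩
    exact absurd ((hint b q).1 hbq).1 (not_le.2 hqb)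
  obtain ⟨i, hi, h⟩ := SomewhereDense.of_biUnion _ ((hseg b hb).2.mono hsub)
  exact hYL i hi b (hZY hb) h

theorem IsLinearOrder.of_comp_injective {α β : Type*} {r : α → α → Prop} (hr : IsLinearOrder α r)
    {f : β → α} (hf : Function.Injective f) : IsLinearOrder β fun x y => r (f x) (f y) where
  refl x := hr.refl (f x)
  trans _ _ _ := hr.trans _ _ _
  antisymm _ _ h h' := hf (hr.antisymm _ _ h h')
  total x y := hr.total (f x) (f y)

/-- If the order of a poset `P` is the intersection of finitely many scattered linear
orders, then neither `Ω(η)` (that is, `ℚ` ordered by `q ⊑ q' ↔ q ≤ q' ∧ e q ≤ e q'`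
for an injection `e : ℚ → ℕ`) nor its dual embeds into `P`. -/
theorem omega_eta_not_embeddable_of_inter_scattered_linear_orders
    {α : Type*} [PartialOrder α] (n : ℕ) (r : Fin n → α → α → Prop)
    (hlin : ∀ i, IsLinearOrder α (r i))
    (hscat : ∀ i, NoRatEmbedRel (r i))
    (hint : ∀ a b : α, a ≤ b ↔ ∀ i, r i a b) :
    ∀ e : ℚ → ℕ, Function.Injective e →
      (¬ ∃ f : ℚ → α, ∀ q q' : ℚ, f q ≤ f q' ↔ (q ≤ q' ∧ e q ≤ e q')) ∧
      (¬ ∃ g : ℚ → α, ∀ q q' : ℚ, g q ≤ g q' ↔ (q' ≤ q ∧ e q' ≤ e q)) := by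
  intro e he
  constructor
  · rintro ⟨f, hf⟩
    have hinj : Function.Injective f := fun q q' h =>
      le_antisymm ((hf q q').1 h.le).1 ((hf q' q).1 h.ge).1
    refine omega_eta_ne_inter_scattered he (fun i => (hlin i).of_comp_injective hinj)
      (fun i => ?_) fun q q' => (hint _ _).symm.trans (hf q q')
    rintro ⟨φ, hφ⟩
    exact hscat i ⟨f ∘ φ, hφ⟩
  · rintro ⟨g, hg⟩
    have hinj : Function.Injective g := fun q q' h =>
      le_antisymm ((hg q' q).1 h.ge).1 ((hg q q').1 h.le).1
    refine omega_eta_ne_inter_scattered he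
      (L := fun i q q' => r i (g q') (g q)) (fun i => ?_)
      (fun i => ?_) fun q q' => (hint _ _).symm.trans (hg q' q)
    · have h := (hlin i).of_comp_injective hinj
      exact { refl := h.refl
              trans := fun x y z hxy hyz => h.trans _ _ _ hyz hxy
              antisymm := fun x y hxy hyx => h.antisymm _ _ hyx hxy
              total := fun x y => h.total y x }
    · rintro ⟨φ, hφ⟩
      exact hscat i ⟨fun q => g (φ (-q)), fun q q' => neg_le_neg_iff.symm.trans (hφ _ _)⟩
end

section
/- Let P be a poset whose order is the intersection of finitely many scattered linear orders; that is, there exist n : ℕ and linear orders r 1, …, r n on the underlying set of P, none of which admits an order embedding of ℚ, such that for all a, b one has a ≤ b ↔ (for every i, r i a b). Then there is no injective map f : ℚ × Bool → P such that for all (q, i), (q', j), f (q, i) ≤ f (q', j) ↔ ((q, i) = (q', j), or (q < q' and i = false and j = true)); that is, the open split B(η̌) of the chain ℚ does not embed into P. -/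
/-- In a finite colouring of an interval of a dense linear order, some colour is dense in some
subinterval. -/
theorem exists_color_dense_in_Ioo {β ι : Type*} [LinearOrder β] [DenselyOrdered β]
    (c : β → ι) (T : Finset ι) {x y : β} (hxy : x < y)
    (hT : ∀ w ∈ Set.Ioo x y, c w ∈ T) :
    ∃ i, ∃ x' y', x' < y' ∧
      ∀ u v, x' ≤ u → u < v → v ≤ y' → ∃ w ∈ Set.Ioo u v, c w = i := by
  classical
  induction T using Finset.induction_on generalizing x y with
  | empty =>
    obtain ⟨w, hw⟩ := exists_between hxy
    simpa using hT w hw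
  | insert i T _ ih =>
    by_cases h : ∀ u v, x ≤ u → u < v → v ≤ y → ∃ w ∈ Set.Ioo u v, c w = i
    · exact ⟨i, x, y, hxy, h⟩
    · push Not at h
      obtain ⟨u, v, hu, huv, hv, hc⟩ := h
      refine ih huv fun w hw => ?_
      exact Finset.mem_of_mem_insert_of_ne
        (hT w ⟨hu.trans_lt hw.1, hw.2.trans_le hv⟩) (hc w hw)

/-- In a finite colouring of `ℚ`, some colour class contains a copy of `ℚ`. -/
theorem exists_strictMono_rat_monochromatic {ι : Type*} [Finite ι] (c : ℚ → ι) :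
    ∃ i, ∃ g : ℚ → ℚ, StrictMono g ∧ ∀ q, c (g q) = i := by
  have := Fintype.ofFinite ι
  obtain ⟨i, x, y, hxy, h⟩ := exists_color_dense_in_Ioo c Finset.univ zero_lt_one
    fun w _ => Finset.mem_univ (c w)
  let S := {w : ℚ // w ∈ Set.Ioo x y ∧ c w = i}
  obtain ⟨m, hm, hmc⟩ := h x y le_rfl hxy le_rfl
  obtain ⟨k, hk, hkc⟩ := h m y hm.1.le hm.2 le_rfl
  have : Nontrivial S :=
    ⟨⟨m, hm, hmc⟩, ⟨k, ⟨hm.1.trans hk.1, hk.2⟩, hkc⟩, fun e => hk.1.ne (congrArg Subtype.val e)⟩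
  have : DenselyOrdered S := ⟨fun a b hab => by
    obtain ⟨w, hw, hwc⟩ := h a.1 b.1 a.2.1.1.le hab b.2.1.2.le
    exact ⟨⟨w, ⟨a.2.1.1.trans hw.1, hw.2.trans b.2.1.2⟩, hwc⟩, hw.1, hw.2⟩⟩
  obtain ⟨g⟩ := Order.embedding_from_countable_to_dense ℚ S
  exact ⟨i, fun q => (g q).1, fun _ _ hq => g.strictMono hq, fun q => (g q).2.2⟩

/-- If the order of a poset `P` is the intersection of finitely many scattered linear
orders, then the open split `B(η̌)` of the chain `ℚ` (that is, `ℚ × Bool` ordered by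
`(q, i) ≤ (q', j) ↔ (q, i) = (q', j) ∨ (q < q' ∧ i = false ∧ j = true)`)
does not embed into `P`. -/
theorem open_split_eta_not_embeddable_of_inter_scattered_linear_orders
    {α : Type*} [PartialOrder α] (n : ℕ) (r : Fin n → α → α → Prop)
    (hlin : ∀ i, IsLinearOrder α (r i))
    (hscat : ∀ i, NoRatEmbedRel (r i))
    (hint : ∀ a b : α, a ≤ b ↔ ∀ i, r i a b) :
    ¬ ∃ f : ℚ × Bool → α, Function.Injective f ∧
      ∀ p p' : ℚ × Bool, f p ≤ f p' ↔
        (p = p' ∨ (p.1 < p'.1 ∧ p.2 = false ∧ p'.2 = true)) := by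
  rintro ⟨f, hf, hle⟩
  have hflip : ∀ q, ∃ i, ¬ r i (f (q, false)) (f (q, true)) := fun q => by
    rw [← not_forall, ← hint, hle]
    simp
  choose c hc using hflip
  obtain ⟨i, g, hg, hgc⟩ := exists_strictMono_rat_monochromatic c
  have := hlin i
  have hmono : ∀ q q', q < q' → r i (f (g q, false)) (f (g q', false)) := fun q q' hq => by
    refine _root_.trans ((hint _ _).1 ((hle (g q, false) (g q', true)).2
      (Or.inr ⟨hg hq, rfl, rfl⟩)) i) ?_
    have hq' := hc (g q')
    rw [hgc] at hq'
    exact (total_of (r i) _ _).resolve_left hq'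
  refine hscat i ⟨fun q => f (g q, false), fun q q' => ⟨fun h => ?_, fun h => ?_⟩⟩
  · rcases h.eq_or_lt with rfl | h
    · exact refl_of (r i) _
    · exact hmono _ _ h
  · by_contra! hlt
    have e := hf (antisymm_of (r i) h (hmono _ _ hlt))
    exact (hg hlt).ne' (congrArg Prod.fst e)
end

section
/- Let P be a poset and let B(P) be its split, i.e., the partial order on P × Bool given by (x, i) ≤ (y, j) iff (x, i) = (y, j), or (x ≤ y in P and i = false and j = true). Then the order on P is the intersection of finitely many scattered linear orders (i.e., there exist n : ℕ and linear orders r 1, …, r n on P, none admitting an order embedding of ℚ, with a ≤ b ↔ ∀ i, r i a b) if and only if the order on B(P) is the intersection of finitely many scattered linear orders on P × Bool. -/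
/-- The split `B(P)` of a poset: `P × Bool` with
`(x, i) ≤ (y, j) ↔ (x, i) = (y, j) ∨ (x ≤ y ∧ i = false ∧ j = true)`. -/
def SplitLe {α : Type*} [PartialOrder α] (p q : α × Bool) : Prop :=
  p = q ∨ (p.1 ≤ q.1 ∧ p.2 = false ∧ q.2 = true)

/-- A total preorder into which `ℚ` does not embed. -/
structure IsScatteredPreorder {α : Type*} (r : α → α → Prop) : Prop where
  total : ∀ a b, r a b ∨ r b a
  trans : ∀ a b c, r a b → r b c → r a c
  noRatEmbed : NoRatEmbedRel r

/-- The lexicographic combination of two relations: compare by `r`, break ties by `s`. -/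
def lexRel {α : Type*} (r s : α → α → Prop) (a b : α) : Prop :=
  r a b ∧ (r b a → s a b)

/-- The lexicographic combination of a list of relations. -/
def lexList {α : Type*} (l : List (α → α → Prop)) : α → α → Prop :=
  l.foldr lexRel fun _ _ => True

theorem lexRel_antisymm_iff {α : Type*} {r s : α → α → Prop} {a b : α} :
    lexRel r s a b ∧ lexRel r s b a ↔ (r a b ∧ r b a) ∧ (s a b ∧ s b a) := by
  unfold lexRel
  tauto

theorem IsLinearOrder.isScatteredPreorder {α : Type*} {r : α → α → Prop}
    (hr : IsLinearOrder α r) (h : NoRatEmbedRel r) : IsScatteredPreorder r :=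
  ⟨hr.total, hr.trans, h⟩

namespace IsScatteredPreorder

variable {α β : Type*} {r s : α → α → Prop}

theorem isLinearOrder (hr : IsScatteredPreorder r) (h : ∀ a b, r a b → r b a → a = b) :
    IsLinearOrder α r where
  refl a := (hr.total a a).elim id id
  trans := hr.trans
  antisymm := h
  total := hr.total

theorem comap (hr : IsScatteredPreorder r) (g : β → α) :
    IsScatteredPreorder fun a b => r (g a) (g b) where
  total _ _ := hr.total _ _
  trans _ _ _ := hr.trans _ _ _
  noRatEmbed := fun ⟨f, hf⟩ => hr.noRatEmbed ⟨g ∘ f, hf⟩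

theorem flip (hr : IsScatteredPreorder r) : IsScatteredPreorder fun a b => r b a where
  total _ _ := hr.total _ _
  trans _ _ _ hab hbc := hr.trans _ _ _ hbc hab
  noRatEmbed := fun ⟨f, hf⟩ =>
    hr.noRatEmbed ⟨fun q => f (-q), fun q q' => neg_le_neg_iff.symm.trans (hf (-q') (-q))⟩

theorem of_finite [Finite α] [LinearOrder α] :
    IsScatteredPreorder fun a b : α => a ≤ b where
  total := le_total
  trans _ _ _ := le_trans
  noRatEmbed := fun ⟨f, hf⟩ =>
    not_injective_infinite_finite f fun _ _ h =>
      le_antisymm ((hf _ _).2 h.le) ((hf _ _).2 h.ge)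

theorem const_true : IsScatteredPreorder fun _ _ : α => True :=
  (of_finite (α := Unit)).comap fun _ => ()

theorem lexRel (hr : IsScatteredPreorder r) (hs : IsScatteredPreorder s) :
    IsScatteredPreorder (lexRel r s) where
  total a b := by
    have := hr.total a b
    have := hs.total a b
    unfold _root_.lexRel
    tauto
  trans a b c := fun ⟨hab, hab'⟩ ⟨hbc, hbc'⟩ =>
    ⟨hr.trans _ _ _ hab hbc, fun hca =>
      hs.trans _ _ _ (hab' (hr.trans _ _ _ hbc hca)) (hbc' (hr.trans _ _ _ hca hab))⟩
  noRatEmbed := by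
    rintro ⟨f, hf⟩
    have mono : ∀ {q q'}, q ≤ q' → r (f q) (f q') := fun h => ((hf _ _).1 h).1
    by_cases h : ∃ a b, a < b ∧ r (f b) (f a)
    · obtain ⟨a, b, hab, hba⟩ := h
      have : Nontrivial (Set.Ioo a b) := by
        obtain ⟨c, hac, hcb⟩ := exists_between hab
        obtain ⟨d, hcd, hdb⟩ := exists_between hcb
        exact ⟨⟨c, hac, hcb⟩, ⟨d, hac.trans hcd, hdb⟩, fun h => hcd.ne (congrArg Subtype.val h)⟩
      obtain ⟨e⟩ := Order.embedding_from_countable_to_dense ℚ (Set.Ioo a b)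
      refine hs.noRatEmbed ⟨fun q => f (e q), fun q q' => ?_⟩
      have key : ∀ p p', r (f (e p)) (f (e p')) := fun p p' =>
        hr.trans _ _ _ (mono (e p).2.2.le) (hr.trans _ _ _ hba (mono (e p').2.1.le))
      rw [← e.le_iff_le, ← Subtype.coe_le_coe, hf]
      exact ⟨fun h => h.2 (key _ _), fun h => ⟨key _ _, fun _ => h⟩⟩
    · push Not at h
      exact hr.noRatEmbed ⟨f, fun q q' => ⟨mono, fun hq => not_lt.1 fun hlt => h _ _ hlt hq⟩⟩

theorem lexList {l : List (α → α → Prop)} (hl : ∀ r ∈ l, IsScatteredPreorder r) :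
    IsScatteredPreorder (lexList l) := by
  induction l with
  | nil => exact const_true
  | cons r l ih =>
    rw [List.forall_mem_cons] at hl
    exact hl.1.lexRel (ih hl.2)

end IsScatteredPreorder

theorem lexList_of_forall {α : Type*} {l : List (α → α → Prop)} {a b : α}
    (h : ∀ r ∈ l, r a b) : lexList l a b := by
  induction l with
  | nil => trivial
  | cons r l ih =>
    rw [List.forall_mem_cons] at h
    exact ⟨h.1, fun _ => ih h.2⟩

theorem lexList_antisymm {α : Type*} {l : List (α → α → Prop)} {a b : α}
    (hab : lexList l a b) (hba : lexList l b a) : ∀ r ∈ l, r a b ∧ r b a := by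
  induction l with
  | nil => simp
  | cons r l ih =>
    obtain ⟨h₁, h₂⟩ := lexRel_antisymm_iff.1 ⟨hab, hba⟩
    exact List.forall_mem_cons.2 ⟨h₁, ih h₂.1 h₂.2⟩

/-- Compare `x` and `y` by inclusion of the initial segments of `r` generated by the images under
`l` of the elements below `x` and below `y`. -/
def segmentRel {α β : Type*} [Preorder α] (r : β → β → Prop) (l : α → β) (x y : α) : Prop :=
  ∀ w ≤ x, ∃ v ≤ y, r (l w) (l v)

theorem IsScatteredPreorder.segmentRel {α β : Type*} [Preorder α] {r : β → β → Prop}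
    (hr : IsScatteredPreorder r) (l : α → β) : IsScatteredPreorder (segmentRel r l) where
  total x y := by
    by_contra! h
    unfold _root_.segmentRel at h
    push Not at h
    obtain ⟨⟨w, hw, hwy⟩, v, hv, hvx⟩ := h
    exact (hr.total (l w) (l v)).elim (hwy v hv) (hvx w hw)
  trans x y z hxy hyz w hw := by
    obtain ⟨v, hv, hwv⟩ := hxy w hw
    obtain ⟨u, hu, hvu⟩ := hyz v hv
    exact ⟨u, hu, hr.trans _ _ _ hwv hvu⟩
  noRatEmbed := by
    rintro ⟨f, hf⟩
    have : Countable (ℚ ×ₗ Bool) := ofLex.injective.countable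
    obtain ⟨e⟩ := Order.embedding_from_countable_to_dense (ℚ ×ₗ Bool) ℚ
    have hgap : ∀ q : ℚ, ∃ w ≤ f (e (toLex (q, true))),
        ∀ v ≤ f (e (toLex (q, false))), ¬ r (l w) (l v) := by
      intro q
      have hlt : e (toLex (q, false)) < e (toLex (q, true)) :=
        e.lt_iff_lt.2 (Prod.Lex.toLex_lt_toLex.2 (Or.inr ⟨rfl, Bool.false_lt_true⟩))
      have := mt (hf _ _).2 hlt.not_ge
      unfold _root_.segmentRel at this
      push Not at this
      exact this
    choose w hw hwv using hgap
    have hlt : ∀ q q', q < q' → r (l (w q)) (l (w q')) ∧ ¬ r (l (w q')) (l (w q)) := by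
      intro q q' hq
      have hle : e (toLex (q, true)) ≤ e (toLex (q', false)) :=
        e.le_iff_le.2 (Prod.Lex.toLex_le_toLex.2 (Or.inl hq))
      obtain ⟨v, hv, hqv⟩ := (hf _ _).1 hle _ (hw q)
      have hn := hwv q' v hv
      exact ⟨hr.trans _ _ _ hqv ((hr.total _ _).resolve_left hn),
        fun h => hn (hr.trans _ _ _ h hqv)⟩
    refine hr.noRatEmbed ⟨fun q => l (w q), fun q q' => ⟨fun h => ?_, fun h => ?_⟩⟩
    · obtain rfl | h := h.eq_or_lt
      · exact (hr.total _ _).elim id id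
      · exact (hlt _ _ h).1
    · exact not_lt.1 fun h' => (hlt _ _ h').2 h

theorem segmentRel_of_le {α β : Type*} [Preorder α] {r : β → β → Prop}
    (hr : IsScatteredPreorder r) (l : α → β) {x y : α} (h : x ≤ y) : segmentRel r l x y :=
  fun w hw => ⟨w, hw.trans h, (hr.total _ _).elim id id⟩

/-- If the order of `B(P)` is the intersection of `n` scattered linear orders, so is that of `P`. -/
theorem exists_realizer_of_split {α : Type*} [PartialOrder α] {n : ℕ}
    {r : Fin n → α × Bool → α × Bool → Prop} (hr : ∀ i, IsScatteredPreorder (r i))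
    (h : ∀ a b, SplitLe a b ↔ ∀ i, r i a b) :
    ∃ s : Fin n → α → α → Prop, (∀ i, IsLinearOrder α (s i)) ∧ (∀ i, NoRatEmbedRel (s i)) ∧
      ∀ a b, a ≤ b ↔ ∀ i, s i a b := by
  set t : Fin n → α → α → Prop := fun i => segmentRel (r i) (·, false) with ht
  have hts i : IsScatteredPreorder (t i) := (hr i).segmentRel _
  have mono i {x y} (hxy : x ≤ y) : t i x y := segmentRel_of_le (hr i) _ hxy
  have key {x y} (hxy : ∀ i, t i x y) : x ≤ y := by
    have : SplitLe (x, false) (y, true) := (h _ _).2 fun i => by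
      obtain ⟨v, hv, hxv⟩ := hxy i x le_rfl
      exact (hr i).trans _ _ _ hxv ((h _ _).1 (Or.inr ⟨hv, rfl, rfl⟩) i)
    simpa [SplitLe] using this
  have hl := IsScatteredPreorder.lexList (l := List.ofFn t) (by simpa [List.mem_ofFn] using hts)
  have hs i := (hts i).lexRel hl
  refine ⟨fun i => lexRel (t i) (lexList (List.ofFn t)), fun i => (hs i).isLinearOrder ?_,
    fun i => (hs i).noRatEmbed, fun a b => ⟨fun hab i => ⟨mono i hab, fun _ => ?_⟩,
      fun hab => key fun i => (hab i).1⟩⟩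
  · intro a b hab hba
    have := lexList_antisymm (lexRel_antisymm_iff.1 ⟨hab, hba⟩).2.1
      (lexRel_antisymm_iff.1 ⟨hab, hba⟩).2.2
    simp only [List.mem_ofFn, forall_exists_index, forall_apply_eq_imp_iff] at this
    exact le_antisymm (key fun i => (this i).1) (key fun i => (this i).2)
  · exact lexList_of_forall (by simpa [List.mem_ofFn] using fun i => mono i hab)

/-- If the order of `P` is the intersection of `n` scattered linear orders and has a scattered
linear extension, then the order of `B(P)` is the intersection of `n + 1` of them. -/
theorem exists_split_realizer {α : Type*} [PartialOrder α] {n : ℕ}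
    {r : Fin n → α → α → Prop} (hr : ∀ i, IsLinearOrder α (r i))
    (hsc : ∀ i, NoRatEmbedRel (r i)) {r₀ : α → α → Prop} (hr₀ : IsLinearOrder α r₀)
    (hsc₀ : NoRatEmbedRel r₀) (hle₀ : ∀ a b, a ≤ b → r₀ a b)
    (h : ∀ a b, a ≤ b ↔ ∀ i, r i a b) :
    ∃ s : Fin (n + 1) → α × Bool → α × Bool → Prop, (∀ i, IsLinearOrder (α × Bool) (s i)) ∧
      (∀ i, NoRatEmbedRel (s i)) ∧ ∀ a b, SplitLe a b ↔ ∀ i, s i a b := by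
  have hB : IsScatteredPreorder fun p q : α × Bool => p.2 ≤ q.2 :=
    IsScatteredPreorder.of_finite.comap Prod.snd
  have hs₀ := hB.lexRel ((hr₀.isScatteredPreorder hsc₀).comap Prod.fst).flip
  have hs i := (((hr i).isScatteredPreorder (hsc i)).comap Prod.fst).lexRel hB
  have hlin₀ := hs₀.isLinearOrder fun a b hab hba => by
    obtain ⟨h₁, h₂⟩ := lexRel_antisymm_iff.1 ⟨hab, hba⟩
    exact Prod.ext (hr₀.antisymm _ _ h₂.2 h₂.1) (le_antisymm h₁.1 h₁.2)
  have hlin i := (hs i).isLinearOrder fun a b hab hba => by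
    obtain ⟨h₁, h₂⟩ := lexRel_antisymm_iff.1 ⟨hab, hba⟩
    exact Prod.ext ((hr i).antisymm _ _ h₁.1 h₁.2) (le_antisymm h₂.1 h₂.2)
  refine ⟨Fin.cons (lexRel (fun p q => p.2 ≤ q.2) fun p q => r₀ q.1 p.1) fun i =>
    lexRel (fun p q => r i p.1 q.1) fun p q => p.2 ≤ q.2,
    Fin.cases hlin₀ hlin, Fin.cases hs₀.noRatEmbed fun i => (hs i).noRatEmbed, ?_⟩
  rintro ⟨x, i⟩ ⟨y, j⟩
  rw [Fin.forall_fin_succ]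
  simp only [Fin.cons_zero, Fin.cons_succ]
  constructor
  · rintro (hab | ⟨hxy, hi, hj⟩)
    · rw [← hab]
      exact ⟨(hs₀.total _ _).elim id id, fun i => ((hs i).total _ _).elim id id⟩
    · simp only at hxy hi hj
      subst hi hj
      exact ⟨⟨Bool.false_le true, fun h => absurd h Bool.false_lt_true.not_ge⟩,
        fun i => ⟨(h x y).1 hxy i, fun _ => Bool.false_le true⟩⟩
  · rintro ⟨⟨hij, hyx⟩, hxy⟩
    have hle : x ≤ y := (h x y).2 fun i => (hxy i).1
    rcases hij.eq_or_lt with hij | hij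
    · have hij : i = j := hij
      subst hij
      exact Or.inl (by rw [hr₀.antisymm x y (hle₀ _ _ hle) (hyx le_rfl)])
    · exact Or.inr ⟨hle, Bool.lt_iff.1 hij⟩

/-- The order of a poset `P` is the intersection of finitely many scattered linear orders
if and only if the order of its split `B(P)` is the intersection of finitely many
scattered linear orders. -/
theorem inter_scattered_linear_orders_iff_split
    {α : Type*} [PartialOrder α] :
    (∃ (n : ℕ) (r : Fin n → α → α → Prop),
        (∀ i, IsLinearOrder α (r i)) ∧
        (∀ i, NoRatEmbedRel (r i)) ∧
        (∀ a b : α, a ≤ b ↔ ∀ i, r i a b)) ↔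
    (∃ (n : ℕ) (r : Fin n → (α × Bool) → (α × Bool) → Prop),
        (∀ i, IsLinearOrder (α × Bool) (r i)) ∧
        (∀ i, NoRatEmbedRel (r i)) ∧
        (∀ a b : α × Bool, SplitLe a b ↔ ∀ i, r i a b)) := by
  constructor
  · rintro ⟨n, r, hr, hsc, h⟩
    cases n with
    | zero =>
      have htrue := IsScatteredPreorder.const_true (α := α)
      exact ⟨_, exists_split_realizer hr hsc (htrue.isLinearOrder fun a b _ _ =>
        le_antisymm ((h a b).2 nofun) ((h b a).2 nofun)) htrue.noRatEmbed
        (fun _ _ _ => trivial) h⟩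
    | succ _ =>
      exact ⟨_, exists_split_realizer hr hsc (hr 0) (hsc 0) (fun a b hab => (h a b).1 hab 0) h⟩
  · rintro ⟨n, r, hr, hsc, h⟩
    exact ⟨n, exists_realizer_of_split (fun i => (hr i).isScatteredPreorder (hsc i)) h⟩
end

section
/- Let T be a distributive lattice and n a positive integer. The following are equivalent: (i) there exist linear orders r 1, …, r n on the underlying set of T, none admitting an order embedding of ℚ, such that a ≤ b ↔ ∀ i, r i a b; (ii) there exist linearly ordered types C 1, …, C n, none admitting an order embedding of ℚ, and an injective lattice homomorphism from T into the product lattice C 1 × ⋯ × C n (each C i a lattice under max and min, the product taken componentwise); (iii) there exist linear orders s 1, …, s n on T with a ≤ b ↔ ∀ i, s i a b, and there is no order embedding of ℚ into T. -/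
universe u

theorem noRatEmbedRel_le_iff {C : Type*} [LinearOrder C] :
    NoRatEmbedRel (fun x y : C => x ≤ y) ↔ ∀ f : ℚ → C, ¬ StrictMono f := by
  constructor
  · exact fun h f hf => h ⟨f, fun _ _ => hf.le_iff_le.symm⟩
  · rintro h ⟨f, hf⟩
    exact h f (strictMono_of_le_iff_le hf)

/-- A monotone map from `ℚ` to a scattered chain is constant on a copy of `ℚ`. -/
theorem Monotone.exists_strictMono_comp_const {C : Type*} [LinearOrder C]
    (hC : ∀ f : ℚ → C, ¬ StrictMono f) {m : ℚ → C} (hm : Monotone m) :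
    ∃ e : ℚ → ℚ, StrictMono e ∧ ∀ q q', m (e q) = m (e q') := by
  have hns := hC m
  simp only [StrictMono, not_forall, not_lt] at hns
  obtain ⟨a, b, hab, hba⟩ := hns
  obtain ⟨c, hac, hcb⟩ := exists_between hab
  obtain ⟨d, hcd, hdb⟩ := exists_between hcb
  have : Nontrivial (Set.Ioo a b) :=
    ⟨⟨⟨c, hac, hcb⟩, ⟨d, hac.trans hcd, hdb⟩, fun h => hcd.ne (congrArg Subtype.val h)⟩⟩
  obtain ⟨e⟩ := Order.embedding_from_countable_to_dense ℚ (Set.Ioo a b)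
  have hconst (q : ℚ) : m (e q) = m a :=
    le_antisymm ((hm (e q).2.2.le).trans hba) (hm (e q).2.1.le)
  exact ⟨fun q => e q, fun _ _ h => e.strictMono h,
    fun q q' => (hconst q).trans (hconst q').symm⟩

/-- A lexicographic product of two scattered chains is scattered. -/
theorem not_strictMono_prodLex {A B : Type*} [LinearOrder A] [LinearOrder B]
    (hA : ∀ f : ℚ → A, ¬ StrictMono f) (hB : ∀ f : ℚ → B, ¬ StrictMono f)
    (f : ℚ → A ×ₗ B) : ¬ StrictMono f := by
  intro hf
  obtain ⟨e, he, hconst⟩ := Monotone.exists_strictMono_comp_const hA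
    (m := fun q => (ofLex (f q)).1) fun q q' h => by
      rcases Prod.Lex.le_iff.1 (hf.monotone h) with h | h
      · exact h.le
      · exact h.1.le
  refine hB (fun q => (ofLex (f (e q))).2) fun q q' h => ?_
  rcases Prod.Lex.lt_iff.1 (hf (he h)) with h | h
  · exact absurd (hconst q q') h.ne
  · exact h.2

/-- A finite lexicographic product of scattered chains is scattered. -/
theorem not_strictMono_piLex {n : ℕ} {C : Fin n → Type*} [∀ i, LinearOrder (C i)]
    (hC : ∀ i, ∀ f : ℚ → C i, ¬ StrictMono f) (f : ℚ → Lex (∀ i, C i)) :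
    ¬ StrictMono f := by
  intro hf
  have key : ∀ k ≤ n, ∃ e : ℚ → ℚ, StrictMono e ∧
      ∀ j : Fin n, j.val < k → ∀ q q', f (e q) j = f (e q') j := by
    intro k
    induction k with
    | zero => exact fun _ => ⟨id, strictMono_id, fun j hj => absurd hj (Nat.not_lt_zero _)⟩
    | succ k ih =>
      intro hk
      obtain ⟨e, he, hconst⟩ := ih (Nat.le_of_succ_le hk)
      obtain ⟨e', he', hconst'⟩ := Monotone.exists_strictMono_comp_const (hC ⟨k, hk⟩)
        (m := fun q => f (e q) ⟨k, hk⟩) fun q q' h => by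
          rcases h.eq_or_lt with rfl | h
          · exact le_rfl
          obtain ⟨i, hi, hlt⟩ := hf (he h)
          rcases lt_trichotomy i.val k with hik | hik | hik
          · exact absurd (hconst i hik q q') hlt.ne
          · obtain rfl : i = ⟨k, hk⟩ := Fin.ext hik
            exact hlt.le
          · exact (hi ⟨k, hk⟩ hik).le
      refine ⟨e ∘ e', he.comp he', fun j hj q q' => ?_⟩
      rcases (Nat.lt_succ_iff.1 hj).eq_or_lt with h | h
      · obtain rfl : j = ⟨k, hk⟩ := Fin.ext h
        exact hconst' q q'
      · exact hconst j h _ _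
  obtain ⟨e, he, hconst⟩ := key n le_rfl
  obtain ⟨i, -, hlt⟩ := hf (he zero_lt_one)
  exact hlt.ne (hconst i i.2 _ _)

/-- Fibres of a lattice homomorphism onto a chain interpolate between finite sets. -/
theorem LatticeHom.exists_eq_between {α C : Type*} [Lattice α] [LinearOrder C]
    (f : LatticeHom α C) (x : α) (A B : Finset α) (hAB : ∀ a ∈ A, ∀ b ∈ B, a ≤ b)
    (hA : ∀ a ∈ A, f a ≤ f x) (hB : ∀ b ∈ B, f x ≤ f b) :
    ∃ y, f y = f x ∧ (∀ a ∈ A, a ≤ y) ∧ ∀ b ∈ B, y ≤ b := by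
  classical
  induction B using Finset.induction_on with
  | empty =>
    clear hAB hB
    induction A using Finset.induction_on with
    | empty => exact ⟨x, rfl, by simp, by simp⟩
    | insert c A _ ih =>
      obtain ⟨y, hy, hAy, -⟩ := ih fun a ha => hA a (Finset.mem_insert_of_mem ha)
      refine ⟨y ⊔ c, ?_, ?_, by simp⟩
      · rw [map_sup, hy, sup_eq_left]
        exact hA c (Finset.mem_insert_self c A)
      · intro a ha
        rcases Finset.mem_insert.1 ha with rfl | ha
        · exact le_sup_right
        · exact (hAy a ha).trans le_sup_left
  | insert c B _ ih =>
    obtain ⟨y, hy, hAy, hyB⟩ := ih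
      (fun a ha b hb => hAB a ha b (Finset.mem_insert_of_mem hb))
      fun b hb => hB b (Finset.mem_insert_of_mem hb)
    refine ⟨y ⊓ c, ?_, fun a ha => le_inf (hAy a ha) (hAB a ha c (Finset.mem_insert_self c B)), ?_⟩
    · rw [map_inf, hy, inf_eq_left]
      exact hB c (Finset.mem_insert_self c B)
    · intro b hb
      rcases Finset.mem_insert.1 hb with rfl | hb
      · exact inf_le_right
      · exact inf_le_left.trans (hyB b hb)

/-- A countable chain lifts along a surjective lattice homomorphism onto a chain. -/
theorem LatticeHom.exists_monotone_lift {ι α C : Type*} [LinearOrder ι] [Countable ι]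
    [Lattice α] [LinearOrder C] (f : LatticeHom α C) (hf : Function.Surjective f)
    {g : ι → C} (hg : Monotone g) : ∃ h : ι → α, Monotone h ∧ ∀ i, f (h i) = g i := by
  classical
  let P : Type _ := {S : Finset (ι × α) //
    (∀ p ∈ S, f p.2 = g p.1) ∧ ∀ p ∈ S, ∀ p' ∈ S, p.1 ≤ p'.1 → p.2 ≤ p'.2}
  let D (i : ι) : Order.Cofinal P :=
    { carrier := {S | ∃ a, (i, a) ∈ S.1}
      isCofinal := by
        rintro ⟨S, hS, hS'⟩
        obtain ⟨x, hx⟩ := hf (g i)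
        obtain ⟨y, hy, hAy, hyB⟩ := f.exists_eq_between x
          ((S.filter fun p => p.1 ≤ i).image Prod.snd)
          ((S.filter fun p => i ≤ p.1).image Prod.snd)
          (by
            simp only [Finset.mem_image, Finset.mem_filter]
            rintro _ ⟨p, ⟨hp, hpi⟩, rfl⟩ _ ⟨p', ⟨hp', hpi'⟩, rfl⟩
            exact hS' p hp p' hp' (hpi.trans hpi'))
          (by
            simp only [Finset.mem_image, Finset.mem_filter]
            rintro _ ⟨p, ⟨hp, hpi⟩, rfl⟩
            rw [hS p hp, hx]
            exact hg hpi)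
          (by
            simp only [Finset.mem_image, Finset.mem_filter]
            rintro _ ⟨p, ⟨hp, hpi⟩, rfl⟩
            rw [hS p hp, hx]
            exact hg hpi)
        refine ⟨⟨insert (i, y) S, ?_, ?_⟩, ⟨y, Finset.mem_insert_self _ _⟩,
          Finset.subset_insert _ _⟩
        · intro p hp
          rcases Finset.mem_insert.1 hp with rfl | hp
          · exact hy.trans hx
          · exact hS p hp
        · intro p hp p' hp' hpp'
          rcases Finset.mem_insert.1 hp with rfl | hp <;>
            rcases Finset.mem_insert.1 hp' with rfl | hp'
          · exact le_rfl
          · exact hyB _ (Finset.mem_image_of_mem _ (Finset.mem_filter.2 ⟨hp', hpp'⟩))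
          · exact hAy _ (Finset.mem_image_of_mem _ (Finset.mem_filter.2 ⟨hp, hpp'⟩))
          · exact hS' p hp p' hp' hpp' }
  have := Encodable.ofCountable ι
  let I : Order.Ideal P := Order.idealOfCofinals ⟨∅, by simp, by simp⟩ D
  have hI (i : ι) : ∃ a, ∃ S ∈ I, (i, a) ∈ S.1 := by
    obtain ⟨S, ⟨a, ha⟩, hS⟩ := Order.cofinal_meets_idealOfCofinals
      (⟨∅, by simp, by simp⟩ : P) D i
    exact ⟨a, S, hS, ha⟩
  choose h S hSI hS using hI
  refine ⟨h, fun i j hij => ?_, fun i => (S i).2.1 _ (hS i)⟩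
  obtain ⟨U, -, hiU, hjU⟩ := I.directed _ (hSI i) _ (hSI j)
  exact U.2.2 _ (hiU (hS i)) _ (hjU (hS j)) hij

/-- The prime ideals of `α` that are initial segments of the relation `s`, and that miss `a`. -/
def primeCutsMissing {α : Type u} [Lattice α] (s : α → α → Prop) (a : α) :
    Set (Order.Ideal α) :=
  {P | P.IsPrime ∧ (∀ x ∈ P, ∀ y ∉ P, ¬ s y x) ∧ a ∉ P}

theorem primeCutsMissing_sup {α : Type u} [Lattice α] (s : α → α → Prop) (a b : α) :
    primeCutsMissing s (a ⊔ b) = primeCutsMissing s a ∪ primeCutsMissing s b := by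
  ext P
  simp only [primeCutsMissing, Set.mem_ofPred_eq, Set.mem_union, Order.Ideal.sup_mem_iff]
  tauto

theorem primeCutsMissing_inf {α : Type u} [Lattice α] (s : α → α → Prop) (a b : α) :
    primeCutsMissing s (a ⊓ b) = primeCutsMissing s a ∩ primeCutsMissing s b := by
  ext P
  simp only [primeCutsMissing, Set.mem_ofPred_eq, Set.mem_inter_iff]
  constructor
  · rintro ⟨h, h', hab⟩
    exact ⟨⟨h, h', fun ha => hab (P.lower inf_le_left ha)⟩,
      h, h', fun hb => hab (P.lower inf_le_right hb)⟩
  · rintro ⟨⟨h, h', ha⟩, -, -, hb⟩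
    exact ⟨h, h', fun hab => (h.mem_or_mem hab).elim ha hb⟩

theorem primeCutsMissing_total {α : Type u} [Lattice α] {s : α → α → Prop}
    [Std.Total s] (a b : α) :
    primeCutsMissing s a ⊆ primeCutsMissing s b ∨
      primeCutsMissing s b ⊆ primeCutsMissing s a := by
  by_contra! h
  obtain ⟨⟨P, hP, hPb⟩, ⟨Q, hQ, hQa⟩⟩ := h.imp Set.not_subset.1 Set.not_subset.1
  have hbP : b ∈ P := by_contra fun hb => hPb ⟨hP.1, hP.2.1, hb⟩
  have haQ : a ∈ Q := by_contra fun ha => hQa ⟨hQ.1, hQ.2.1, ha⟩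
  rcases total_of s a b with hab | hba
  · exact hP.2.1 b hbP a hP.2.2 hab
  · exact hQ.2.1 a haQ b hQ.2.2 hba

/-- The prime ideals of a lattice that are initial segments of a total relation `s` are the
kernel of a surjective lattice homomorphism onto a chain. -/
theorem exists_latticeHom_chain_of_primeCuts {α : Type u} [Lattice α] (s : α → α → Prop)
    [Std.Total s] :
    ∃ (C : Type u) (_ : LinearOrder C) (f : LatticeHom α C), Function.Surjective f ∧
      ∀ a b, f a ≤ f b ↔ primeCutsMissing s a ⊆ primeCutsMissing s b := by
  classical
  have hchain : IsChain (· ≤ ·) (Set.range (primeCutsMissing s)) := by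
    rintro _ ⟨a, rfl⟩ _ ⟨b, rfl⟩ -
    exact primeCutsMissing_total a b
  let : LinearOrder (Set.range (primeCutsMissing s)) := hchain.linearOrder
  let g : α → Set.range (primeCutsMissing s) := fun a => ⟨_, a, rfl⟩
  have hg (a b : α) : g a ≤ g b ↔ primeCutsMissing s a ⊆ primeCutsMissing s b := Iff.rfl
  refine ⟨_, inferInstance, ⟨⟨g, fun a b => ?_⟩, fun a b => ?_⟩, ?_, hg⟩
  · rcases primeCutsMissing_total (s := s) a b with h | h
    · rw [sup_eq_right.2 ((hg a b).2 h)]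
      exact Subtype.ext ((primeCutsMissing_sup s a b).trans (Set.union_eq_right.2 h))
    · rw [sup_eq_left.2 ((hg b a).2 h)]
      exact Subtype.ext ((primeCutsMissing_sup s a b).trans (Set.union_eq_left.2 h))
  · change g (a ⊓ b) = g a ⊓ g b
    rcases primeCutsMissing_total (s := s) a b with h | h
    · rw [inf_eq_left.2 ((hg a b).2 h)]
      exact Subtype.ext ((primeCutsMissing_inf s a b).trans (Set.inter_eq_left.2 h))
    · rw [inf_eq_right.2 ((hg b a).2 h)]
      exact Subtype.ext ((primeCutsMissing_inf s a b).trans (Set.inter_eq_right.2 h))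
  · rintro ⟨_, a, rfl⟩
    exact ⟨a, rfl⟩

/-- If the order of a lattice is an intersection of finitely many linear orders, every prime ideal
is an initial segment of one of them. -/
theorem Order.Ideal.IsPrime.exists_initialSegment {α ι : Type*} [Lattice α] [Finite ι]
    [Nonempty ι] {s : ι → α → α → Prop} [∀ i, IsTrans α (s i)]
    (hs : ∀ a b : α, a ≤ b ↔ ∀ i, s i a b) {P : Order.Ideal α} (hP : P.IsPrime) :
    ∃ i, ∀ x ∈ P, ∀ y ∉ P, ¬ s i y x := by
  cases nonempty_fintype ι
  by_contra! h
  choose b hb a ha hab using h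
  have hbP : Finset.univ.sup' Finset.univ_nonempty b ∈ P :=
    Finset.sup'_mem (P : Set α) (fun _ hx _ hy => Order.Ideal.sup_mem hx hy) _ _ _
      fun i _ => hb i
  have haP : Finset.univ.inf' Finset.univ_nonempty a ∈ (P : Set α)ᶜ :=
    Finset.inf'_mem (P : Set α)ᶜ (fun _ hx _ hy hxy => (hP.mem_or_mem hxy).elim hx hy) _ _ _
      fun i _ => ha i
  refine haP (P.lower ((hs _ _).2 fun i => ?_) hbP)
  exact trans_of (s i) ((hs _ _).1 (Finset.inf'_le a (Finset.mem_univ i)) i)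
    (trans_of (s i) (hab i) ((hs _ _).1 (Finset.le_sup' b (Finset.mem_univ i)) i))

/-- The prime ideals that are initial segments of one of the `s i` separate the points of a
distributive lattice whose order is the intersection of the `s i`. -/
theorem le_of_forall_primeCutsMissing_subset {α ι : Type*} [DistribLattice α] [Finite ι]
    [Nonempty ι] {s : ι → α → α → Prop} [∀ i, IsTrans α (s i)]
    (hs : ∀ a b : α, a ≤ b ↔ ∀ i, s i a b) {a b : α}
    (h : ∀ i, primeCutsMissing (s i) a ⊆ primeCutsMissing (s i) b) : a ≤ b := by
  by_contra hab
  obtain ⟨P, hP, hbP, haP⟩ := DistribLattice.prime_ideal_of_disjoint_filter_ideal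
    (F := Order.PFilter.principal a) (I := Order.Ideal.principal b) (by
      rw [Set.disjoint_left]
      intro x hax hxb
      exact hab (le_trans (Order.PFilter.mem_principal.1 hax) (Order.Ideal.mem_principal.1 hxb)))
  obtain ⟨i, hi⟩ := hP.exists_initialSegment hs
  have haP' : a ∉ P := fun haP'' =>
    Set.disjoint_left.1 haP (Order.PFilter.mem_principal.2 le_rfl) haP''
  exact (h i ⟨hP, hi, haP'⟩).2.2 (hbP (Order.Ideal.mem_principal.2 le_rfl))

/-- The intersection of finitely many scattered partial orders, at least one, is scattered. -/
theorem not_exists_rat_embedding_of_inter {α ι : Type*} [PartialOrder α] [Nonempty ι]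
    {r : ι → α → α → Prop} [∀ i, Std.Antisymm (r i)] (hr : ∀ i, NoRatEmbedRel (r i))
    (h : ∀ a b : α, a ≤ b ↔ ∀ i, r i a b) :
    ¬ ∃ f : ℚ → α, ∀ q q' : ℚ, q ≤ q' ↔ f q ≤ f q' := by
  rintro ⟨f, hf⟩
  obtain ⟨i⟩ := ‹Nonempty ι›
  refine hr i ⟨f, fun q q' => ⟨fun hq => (h _ _).1 ((hf _ _).1 hq) i, fun hq => ?_⟩⟩
  by_contra hlt
  have hr' := (h _ _).1 ((hf _ _).1 (not_le.1 hlt).le) i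
  exact hlt ((hf _ _).2 (antisymm_of (r i) hq hr').le)

/-- A suborder of a finite product of scattered chains is an intersection of that many scattered
linear orders. -/
theorem exists_scattered_linear_of_le_iff {α : Type*} {n : ℕ} {C : Fin n → Type*}
    [PartialOrder α] [∀ i, LinearOrder (C i)] (hC : ∀ i, ∀ f : ℚ → C i, ¬ StrictMono f)
    (f : α → ∀ i, C i) (hf : ∀ a b, a ≤ b ↔ f a ≤ f b) :
    ∃ r : Fin n → α → α → Prop, (∀ i, IsLinearOrder α (r i)) ∧
      (∀ i, NoRatEmbedRel (r i)) ∧ ∀ a b : α, a ≤ b ↔ ∀ i, r i a b := by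
  let φ (i : Fin n) (a : α) : C i ×ₗ Lex (∀ i, C i) := toLex (f a i, toLex (f a))
  have hφ (i : Fin n) : Function.Injective (φ i) := fun a b hab => by
    have hfab : f a = f b := congrArg (fun x => ofLex (ofLex x).2) hab
    exact le_antisymm ((hf _ _).2 hfab.le) ((hf _ _).2 hfab.ge)
  refine ⟨fun i a b => φ i a ≤ φ i b, fun i => ?_, fun i => ?_, fun a b => ?_⟩
  · exact
      { refl := fun a => le_rfl
        trans := fun a b c => le_trans
        antisymm := fun a b h h' => hφ i (le_antisymm h h')
        total := fun a b => le_total _ _ }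
  · rintro ⟨g, hg⟩
    exact not_strictMono_prodLex (hC i) (not_strictMono_piLex hC) (φ i ∘ g)
      (strictMono_of_le_iff_le hg)
  · rw [hf]
    refine ⟨fun h i => Prod.Lex.toLex_mono ⟨h i, Pi.toLex_monotone h⟩, fun h i => ?_⟩
    rcases Prod.Lex.le_iff.1 (h i) with h | h
    · exact h.le
    · exact h.1.le

/-- For a distributive lattice `T` and `n ≥ 1`, the following are equivalent:
(i) the order of `T` is the intersection of `n` scattered linear orders;
(ii) `T` embeds as a lattice into a product of `n` scattered chains;
(iii) `T` has dimension at most `n` and is order-scattered. -/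
theorem distrib_lattice_inter_scattered_tfae
    {α : Type u} [DistribLattice α] (n : ℕ) (hn : 0 < n) :
    ((∃ r : Fin n → α → α → Prop,
        (∀ i, IsLinearOrder α (r i)) ∧
        (∀ i, NoRatEmbedRel (r i)) ∧
        (∀ a b : α, a ≤ b ↔ ∀ i, r i a b)) ↔
      (∃ (C : Fin n → Type u) (inst : ∀ i, LinearOrder (C i)) (f : α → ∀ i, C i),
        (∀ i, NoRatEmbedRel fun x y : C i => (inst i).le x y) ∧
        Function.Injective f ∧
        (∀ a b : α, ∀ i, f (a ⊔ b) i = (inst i).max (f a i) (f b i)) ∧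
        (∀ a b : α, ∀ i, f (a ⊓ b) i = (inst i).min (f a i) (f b i)))) ∧
    ((∃ r : Fin n → α → α → Prop,
        (∀ i, IsLinearOrder α (r i)) ∧
        (∀ i, NoRatEmbedRel (r i)) ∧
        (∀ a b : α, a ≤ b ↔ ∀ i, r i a b)) ↔
      ((∃ s : Fin n → α → α → Prop,
          (∀ i, IsLinearOrder α (s i)) ∧
          (∀ a b : α, a ≤ b ↔ ∀ i, s i a b)) ∧
        ¬ ∃ f : ℚ → α, ∀ q q' : ℚ, q ≤ q' ↔ f q ≤ f q')) := by
  have : Nonempty (Fin n) := ⟨⟨0, hn⟩⟩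
  refine (fun (h12 : _ → _) (h23 : _ → _) (h31 : _ → _) =>
    ⟨⟨fun h => h23 (h12 h), h31⟩, ⟨h12, fun h => h31 (h23 h)⟩⟩) ?_ ?_ ?_
  · rintro ⟨r, hlin, hr, h⟩
    exact ⟨⟨r, hlin, h⟩, not_exists_rat_embedding_of_inter hr h⟩
  · rintro ⟨⟨s, hlin, hs⟩, hα⟩
    choose C inst f hsurj hle using fun i => exists_latticeHom_chain_of_primeCuts (s i)
    refine ⟨C, inst, fun a i => f i a, fun i => ?_, fun a b hab => ?_,
      fun a b i => map_sup (f i) a b, fun a b i => map_inf (f i) a b⟩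
    · rintro ⟨g, hg⟩
      have hg' : StrictMono g := strictMono_of_le_iff_le hg
      obtain ⟨h, hmono, hfg⟩ := (f i).exists_monotone_lift (hsurj i) hg'.monotone
      refine hα ⟨h, fun q q' => ⟨fun hq => hmono hq, fun hq => (hg _ _).2 ?_⟩⟩
      rw [← hfg, ← hfg]
      exact OrderHomClass.mono (f i) hq
    · have hfab (i : Fin n) : f i a = f i b := congrFun hab i
      exact le_antisymm
        (le_of_forall_primeCutsMissing_subset hs fun i => (hle i a b).1 (hfab i).le)
        (le_of_forall_primeCutsMissing_subset hs fun i => (hle i b a).1 (hfab i).ge)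
  · rintro ⟨C, inst, f, hC, hinj, hsup, -⟩
    refine exists_scattered_linear_of_le_iff (fun i => noRatEmbedRel_le_iff.1 (hC i)) f
      fun a b => ?_
    rw [← sup_eq_right, ← hinj.eq_iff, funext_iff]
    exact forall_congr' fun i => by rw [hsup, sup_eq_right]
end

section
/- Let (E, ≤) be a poset with E infinite and let n be a positive integer. Then there exist linear orders r 1, …, r n on E, each order-isomorphic to ℕ, such that a ≤ b ↔ (for every i, r i a b), if and only if all of the following hold: (i) there exist n linear orders on E whose intersection is ≤ (the dimension of the order is at most n); (ii) there is no injective map f : ℕ → E whose values are pairwise incomparable (no infinite antichain); (iii) there is no strictly decreasing map f : ℕ → E (no infinite decreasing chain); (iv) there is no strictly increasing map f : ℕ → E together with an element b such that f k < b for all k (no chain of type ω + 1); (v) there is no strictly increasing map f : ℕ → E together with an element a incomparable to f k for every k (no copy of ω ⊕ 1). -/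
/-- In a partial order without infinite antichains and infinite decreasing chains, every injective
sequence has a strictly increasing subsequence. -/
theorem exists_strictMono_subseq_of_injective {α : Type*} [PartialOrder α]
    (hanti : ¬ ∃ f : ℕ → α, Function.Injective f ∧ ∀ k m : ℕ, k ≠ m → ¬ f k ≤ f m)
    (hdec : ¬ ∃ f : ℕ → α, StrictAnti f) {f : ℕ → α} (hf : Function.Injective f) :
    ∃ g : ℕ ↪o ℕ, StrictMono (f ∘ g) := by
  obtain ⟨g, hg | hg⟩ := exists_increasing_or_nonincreasing_subseq (· < ·) f
  · exact ⟨g, fun m n h ↦ hg m n h⟩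
  obtain ⟨k, hk | hk⟩ := exists_increasing_or_nonincreasing_subseq (· > ·) (f ∘ g)
  · exact (hdec ⟨f ∘ g ∘ k, fun m n h ↦ hk m n h⟩).elim
  have hinj : Function.Injective (f ∘ g ∘ k) := hf.comp (g.injective.comp k.injective)
  refine (hanti ⟨f ∘ g ∘ k, hinj, fun m n hmn hle ↦ ?_⟩).elim
  have hlt : f (g (k m)) < f (g (k n)) := lt_of_le_of_ne hle (hinj.ne hmn)
  rcases lt_or_gt_of_ne hmn with h | h
  · exact hg _ _ (k.strictMono h) hlt
  · exact hk _ _ h hlt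

/-- In a partial order without infinite antichains, infinite decreasing chains, chains of type
`ω + 1` and copies of `ω ⊕ 1`, all but finitely many elements lie above any given one. -/
theorem finite_setOf_not_lt {α : Type*} [PartialOrder α]
    (hanti : ¬ ∃ f : ℕ → α, Function.Injective f ∧ ∀ k m : ℕ, k ≠ m → ¬ f k ≤ f m)
    (hdec : ¬ ∃ f : ℕ → α, StrictAnti f)
    (hbdd : ¬ ∃ (f : ℕ → α) (b : α), StrictMono f ∧ ∀ k, f k < b)
    (hinc : ¬ ∃ (f : ℕ → α) (a : α), StrictMono f ∧ ∀ k, ¬ a ≤ f k ∧ ¬ f k ≤ a) (a : α) :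
    {x | ¬ a < x}.Finite := by
  by_contra hinf
  let u := Set.Infinite.natEmbedding _ hinf
  obtain ⟨g, hg⟩ := exists_strictMono_subseq_of_injective hanti hdec
    (f := fun k ↦ (u k : α)) (Subtype.val_injective.comp u.injective)
  set v : ℕ → α := (fun k ↦ (u k : α)) ∘ g
  have hv : ∀ k, ¬ a < v k := fun k ↦ (u (g k)).2
  by_cases h : ∀ k, v k ≤ a
  · exact hbdd ⟨v, a, hg, fun k ↦ (hg k.lt_succ_self).trans_le (h _)⟩
  · push Not at h
    obtain ⟨k₀, hk₀⟩ := h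
    have hnle : ∀ k, ¬ v (k₀ + k) ≤ a := fun k hk ↦
      hk₀ ((hg.monotone (Nat.le_add_right k₀ k)).trans hk)
    refine hinc ⟨fun k ↦ v (k₀ + k), a, fun m n h ↦ hg (by lia), fun k ↦ ⟨fun hak ↦ ?_, hnle k⟩⟩
    rcases hak.eq_or_lt with h | h
    · exact hnle k h.ge
    · exact hv _ h

/-- An infinite linear order all of whose initial segments are finite has order type `ω`. -/
theorem nonempty_orderIso_nat_of_finite_Iio {α : Type*} [LinearOrder α] [Infinite α]
    (h : ∀ a : α, (Set.Iio a).Finite) : Nonempty (α ≃o ℕ) := by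
  have hmono : StrictMono fun a : α ↦ (Set.Iio a).ncard := fun a b hab ↦
    Set.ncard_lt_ncard (Set.Iio_ssubset_Iio hab) (h b)
  have : Infinite (Set.range fun a : α ↦ (Set.Iio a).ncard) :=
    (Set.infinite_range_of_injective hmono.injective).to_subtype
  classical
  exact ⟨(hmono.orderIso _).trans (Nat.Subtype.orderIsoOfNat _).symm⟩

/-- An infinite relational linear order all of whose initial segments are finite has order
type `ω`. -/
theorem IsLinearOrder.exists_equiv_nat {α : Type*} [Infinite α] {r : α → α → Prop}
    (hr : IsLinearOrder α r) (h : ∀ a, {x | r x a}.Finite) :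
    ∃ e : α ≃ ℕ, ∀ a b, r a b ↔ e a ≤ e b := by
  classical
  let _ : LinearOrder α :=
    { le := r
      le_refl := hr.refl
      le_trans := hr.trans
      le_antisymm := hr.antisymm
      le_total := hr.total
      toDecidableLE := Classical.decRel r }
  obtain ⟨e⟩ := nonempty_orderIso_nat_of_finite_Iio fun a : α ↦
    (h a).subset fun x (hx : x < a) ↦ hx.le
  exact ⟨e.toEquiv, fun a b ↦ e.le_iff_le.symm⟩


/-- An infinite poset is the intersection of `n` linear orders of order type `ω`
if and only if it has dimension at most `n`, no infinite antichain, no infinite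
decreasing chain, no chain of type `ω + 1`, and no copy of `ω ⊕ 1`. -/
theorem inter_omega_linear_orders_iff
    {α : Type*} [PartialOrder α] [Infinite α] (n : ℕ) (hn : 0 < n) :
    (∃ r : Fin n → α → α → Prop,
        (∀ i, IsLinearOrder α (r i)) ∧
        (∀ i, ∃ e : α ≃ ℕ, ∀ a b : α, r i a b ↔ e a ≤ e b) ∧
        (∀ a b : α, a ≤ b ↔ ∀ i, r i a b)) ↔
    ((∃ s : Fin n → α → α → Prop,
        (∀ i, IsLinearOrder α (s i)) ∧
        (∀ a b : α, a ≤ b ↔ ∀ i, s i a b)) ∧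
      (¬ ∃ f : ℕ → α, Function.Injective f ∧
          ∀ k m : ℕ, k ≠ m → ¬ f k ≤ f m) ∧
      (¬ ∃ f : ℕ → α, StrictAnti f) ∧
      (¬ ∃ (f : ℕ → α) (b : α), StrictMono f ∧ ∀ k, f k < b) ∧
      (¬ ∃ (f : ℕ → α) (a : α), StrictMono f ∧ ∀ k, ¬ a ≤ f k ∧ ¬ f k ≤ a)) := by
  constructor
  · rintro ⟨r, hlin, hω, hr⟩
    refine ⟨⟨r, hlin, hr⟩, ?_⟩
    choose e he using hω
    have hle : ∀ a b : α, a ≤ b ↔ ∀ i, e i a ≤ e i b := by simp only [hr, he, implies_true]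
    have hmono : ∀ i, StrictMono (e i) := fun i ↦
      Monotone.strictMono_of_injective (fun a b h ↦ (hle a b).1 h i) (e i).injective
    refine ⟨?_, ?_, ?_, ?_⟩
    · rintro ⟨f, -, hf⟩
      obtain ⟨k, m, hkm, h⟩ := wellQuasiOrdered_le (fun k i ↦ e i (f k))
      exact hf k m hkm.ne ((hle _ _).2 h)
    · rintro ⟨f, hf⟩
      exact not_strictAnti_of_wellFoundedLT _ ((hmono ⟨0, hn⟩).comp_strictAnti hf)
    · rintro ⟨f, b, hf, hb⟩
      exact ((hmono ⟨0, hn⟩).comp hf).le_apply.not_gt (hmono ⟨0, hn⟩ (hb _))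
    · rintro ⟨f, a, hf, ha⟩
      refine (ha (Finset.univ.sup fun i ↦ e i a)).1 ((hle _ _).2 fun i ↦ ?_)
      exact (Finset.le_sup (f := fun i ↦ e i a) (Finset.mem_univ i)).trans
        ((hmono i).comp hf).le_apply
  · rintro ⟨⟨s, hlin, hs⟩, hanti, hdec, hbdd, hinc⟩
    refine ⟨s, hlin, fun i ↦ (hlin i).exists_equiv_nat fun a ↦ ?_, hs⟩
    refine (finite_setOf_not_lt hanti hdec hbdd hinc a).subset fun x hx hax ↦ ?_
    exact hax.ne ((hlin i).antisymm _ _ ((hs a x).1 hax.le i) hx)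
end

section
/- Let C₁ and C₂ be linearly ordered types. If there is a map f : List Bool → C₁ × C₂ such that for all l, l' : List Bool, l is a prefix of l' if and only if f l ≤ f l' in the componentwise order on C₁ × C₂ (i.e., the binary tree T₂ order-embeds into the product of the two chains), then there is an order embedding of ℚ into C₁ and an order embedding of ℚ into C₂ (both chains are non-scattered). -/
/-- In a product of two chains, if `x` and `y` are incomparable nodes of the embedded tree with the
first coordinate of `x` below that of `y`, then the first coordinate of every node extending `x`
stays below that of `y`. -/
theorem fst_lt_of_prefix_of_incomparable {β γ : Type*} [LinearOrder β] [LinearOrder γ]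
    {f : List Bool → β × γ} (hf : ∀ l l' : List Bool, l <+: l' ↔ f l ≤ f l')
    {x y u : List Bool} (hxy : ¬ x <+: y) (hyx : ¬ y <+: x) (hlt : (f x).1 < (f y).1)
    (hu : x <+: u) : (f u).1 < (f y).1 := by
  by_contra! hle
  have hsnd : (f y).2 ≤ (f x).2 := by
    by_contra! h
    exact hxy ((hf x y).2 ⟨hlt.le, h.le⟩)
  have hyu : y <+: u := (hf y u).2 ⟨hle, hsnd.trans ((hf x u).1 hu).2⟩
  exact (List.prefix_or_prefix_of_prefix hu hyu).elim hxy hyx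

/-- Two distinct children of the same node are incomparable. -/
theorem not_append_singleton_prefix {α : Type*} (x : List α) {c d : α} (h : c ≠ d) :
    ¬ x ++ [c] <+: x ++ [d] := by
  simpa using h

/-- The children of each node can be ordered by their first coordinates. -/
theorem exists_fst_append_lt {β γ : Type*} [LinearOrder β] [LinearOrder γ]
    {f : List Bool → β × γ} (hf : ∀ l l' : List Bool, l <+: l' ↔ f l ≤ f l') (x : List Bool) :
    ∃ c d : Bool, c ≠ d ∧ (f (x ++ [c])).1 < (f (x ++ [d])).1 := by
  rcases lt_trichotomy (f (x ++ [false])).1 (f (x ++ [true])).1 with h | h | h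
  · exact ⟨false, true, by decide, h⟩
  · exfalso
    rcases le_total (f (x ++ [false])).2 (f (x ++ [true])).2 with h' | h'
    · exact not_append_singleton_prefix x (by decide) ((hf _ _).2 ⟨h.le, h'⟩)
    · exact not_append_singleton_prefix x (by decide) ((hf _ _).2 ⟨h.ge, h'⟩)
  · exact ⟨true, false, by decide, h⟩

/-- If the binary tree embeds into a product of two chains, then `ℚ` embeds into the first one. -/
theorem exists_rat_embedding_fst {β γ : Type*} [LinearOrder β] [LinearOrder γ]
    (f : List Bool → β × γ) (hf : ∀ l l' : List Bool, l <+: l' ↔ f l ≤ f l') :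
    ∃ g : ℚ → β, ∀ q q' : ℚ, q ≤ q' ↔ g q ≤ g q' := by
  choose c d hne hlt using exists_fst_append_lt hf
  have mono {x y : List Bool} (h : x <+: y) : (f x).1 ≤ (f y).1 := ((hf x y).1 h).1
  have lt_right (x : List Bool) : (f x).1 < (f (x ++ [d x])).1 :=
    (mono (List.prefix_append x [c x])).trans_lt (hlt x)
  let S : Set β := Set.range fun x => (f (x ++ [d x])).1
  have : DenselyOrdered S := by
    refine ⟨?_⟩
    rintro ⟨_, x, rfl⟩ ⟨_, y, rfl⟩ h
    replace h : (f (x ++ [d x])).1 < (f (y ++ [d y])).1 := h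
    suffices H : ∃ z, (f (x ++ [d x])).1 < (f (z ++ [d z])).1 ∧
        (f (z ++ [d z])).1 < (f (y ++ [d y])).1 by
      obtain ⟨z, hz⟩ := H
      exact ⟨⟨_, z, rfl⟩, hz⟩
    have hyx : ¬ y ++ [d y] <+: x ++ [d x] := fun hp => (mono hp).not_gt h
    by_cases hxy : x ++ [d x] <+: y ++ [d y]
    · have hxy' : x ++ [d x] <+: y := by
        rcases List.prefix_concat_iff.1 hxy with he | hp
        · exact absurd (he ▸ List.prefix_rfl) hyx
        · exact hp
      refine ⟨y ++ [c y], ?_, ?_⟩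
      · exact (mono (hxy'.trans (List.prefix_append y [c y]))).trans_lt (lt_right _)
      · exact fst_lt_of_prefix_of_incomparable hf (not_append_singleton_prefix y (hne y))
          (not_append_singleton_prefix y (hne y).symm) (hlt y) (List.prefix_append _ _)
    · exact ⟨x ++ [d x], lt_right _,
        fst_lt_of_prefix_of_incomparable hf hxy hyx h (List.prefix_append _ _)⟩
  have : Nontrivial S :=
    ⟨⟨_, [], rfl⟩, ⟨_, [] ++ [d []], rfl⟩, fun h => (lt_right ([] ++ [d []])).ne (congrArg Subtype.val h)⟩
  obtain ⟨e⟩ := Order.embedding_from_countable_to_dense ℚ S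
  exact ⟨fun q => (e q : β), fun q q' => e.le_iff_le.symm⟩

/-- If the binary tree `T₂ = (List Bool, <+:)` order-embeds into a product of two
chains, then both chains are non-scattered: `ℚ` order-embeds into each of them. -/
theorem rat_embeds_of_binary_tree_embeds_prod_two_chains
    {β γ : Type*} [LinearOrder β] [LinearOrder γ]
    (f : List Bool → β × γ)
    (hf : ∀ l l' : List Bool, l <+: l' ↔ f l ≤ f l') :
    (∃ g : ℚ → β, ∀ q q' : ℚ, q ≤ q' ↔ g q ≤ g q') ∧
    (∃ h : ℚ → γ, ∀ q q' : ℚ, q ≤ q' ↔ h q ≤ h q') :=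
  ⟨exists_rat_embedding_fst f hf,
    exists_rat_embedding_fst (fun l => (f l).swap) fun l l' =>
      (hf l l').trans Prod.swap_le_swap.symm⟩
end

section
/- Let L be a linear order on List Bool that extends the prefix order (if l is a prefix of l' then L l l') and is non-separating: there are no x, y, z : List Bool with x a proper prefix of z, y prefix-incomparable to both x and z, and L x y, L y z with y ≠ x, y ≠ z. Then (List Bool, L) is order-isomorphic to the lexicographic product (PUnit ⊕ ℚ) ×ₗ ℕ, where PUnit ⊕ ℚ is the linear sum with the single point below all rationals and the product is ordered lexicographically with the first coordinate dominant; that is, L has order type ω·(1 + η). -/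
/-- A non-separating linear extension of the prefix order on `List Bool`. -/
structure IsNonseparatingExtension (L : List Bool → List Bool → Prop) : Prop where
  trans : ∀ a b c, L a b → L b c → L a c
  antisymm : ∀ a b, L a b → L b a → a = b
  total : ∀ a b, L a b ∨ L b a
  of_prefix : ∀ a b, a <+: b → L a b
  nonseparating : ∀ x y z : List Bool, x <+: z → x ≠ z → ¬ y <+: x → ¬ x <+: y →
    ¬ y <+: z → ¬ z <+: y → L x y → L y z → False

namespace IsNonseparatingExtension

variable {L : List Bool → List Bool → Prop}

/-- The restriction of a non-separating extension to the cone above a child of the root. -/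
theorem restrict (h : IsNonseparatingExtension L) (c : Bool) :
    IsNonseparatingExtension fun s t => L (c :: s) (c :: t) where
  trans _ _ _ := h.trans _ _ _
  antisymm a b hab hba := (List.cons.inj (h.antisymm _ _ hab hba)).2
  total _ _ := h.total _ _
  of_prefix a b hab := h.of_prefix _ _ (by simpa using hab)
  nonseparating x y z h₁ h₂ h₃ h₄ h₅ h₆ :=
    h.nonseparating (c :: x) (c :: y) (c :: z) (by simpa using h₁) (by simpa using h₂)
      (by simpa using h₃) (by simpa using h₄) (by simpa using h₅) (by simpa using h₆)

theorem cons_of_singleton (h : IsNonseparatingExtension L) {c d : Bool} (hcd : c ≠ d)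
    (hL : L [c] [d]) (s t : List Bool) : L (c :: s) (d :: t) := by
  have hs : L (c :: s) [d] := by
    refine (h.total _ _).resolve_right fun hds => ?_
    rcases eq_or_ne s [] with rfl | hs
    · exact hcd (by simpa using h.antisymm _ _ hL hds)
    · exact h.nonseparating [c] [d] (c :: s) (by simp) (by simpa using hs.symm)
        (by simp [hcd.symm]) (by simp [hcd]) (by simp [hcd.symm]) (by simp [hcd]) hL hds
  exact h.trans _ _ _ hs (h.of_prefix _ _ (by simp))

theorem cons_iff_singleton (h : IsNonseparatingExtension L) {c d : Bool} (hcd : c ≠ d)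
    (s t : List Bool) : L (c :: s) (d :: t) ↔ L [c] [d] := by
  refine ⟨fun hL => (h.total _ _).resolve_right fun hdc => ?_,
    fun hL => h.cons_of_singleton hcd hL s t⟩
  exact hcd (List.cons.inj
    (h.antisymm _ _ hL (h.cons_of_singleton hcd.symm hdc t s))).1

end IsNonseparatingExtension

open Classical in
/-- The automorphism of the binary tree that swaps the two children of a node whenever `L` puts
`true` before `false` there. -/
noncomputable def straighten : (List Bool → List Bool → Prop) → List Bool → List Bool
  | _, [] => []
  | L, c :: s =>
    (if L [false] [true] then c else !c) :: straighten (fun s t => L (c :: s) (c :: t)) s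

theorem straighten_surjective (L : List Bool → List Bool → Prop) :
    Function.Surjective (straighten L) := by
  intro w
  induction w generalizing L with
  | nil => exact ⟨[], rfl⟩
  | cons b w ih =>
    by_cases hL : L [false] [true]
    · obtain ⟨s, hs⟩ := ih fun s t => L (b :: s) (b :: t)
      exact ⟨b :: s, by simp [straighten, hL, hs]⟩
    · obtain ⟨s, hs⟩ := ih fun s t => L ((!b) :: s) ((!b) :: t)
      exact ⟨(!b) :: s, by simp [straighten, hL, hs]⟩

theorem List.cons_le_cons_iff_of_linearOrder {α : Type*} [LinearOrder α] {a b : α}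
    {s t : List α} : a :: s ≤ b :: t ↔ a < b ∨ a = b ∧ s ≤ t := by
  simp only [le_iff_lt_or_eq, List.cons_lt_cons_iff, List.cons.injEq]
  tauto

theorem IsNonseparatingExtension.iff_straighten_le {L : List Bool → List Bool → Prop}
    (h : IsNonseparatingExtension L) (a b : List Bool) :
    L a b ↔ straighten L a ≤ straighten L b := by
  induction a generalizing L b with
  | nil => exact iff_of_true (h.of_prefix _ _ List.nil_prefix) (not_lt.1 (List.not_lt_nil _))
  | cons c s ih =>
    cases b with
    | nil =>
      refine iff_of_false (fun hL => ?_) (not_le.2 (List.nil_lt_cons _ _))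
      exact absurd (h.antisymm _ _ hL (h.of_prefix _ _ List.nil_prefix)) (by simp)
    | cons d t =>
      rcases eq_or_ne c d with rfl | hcd
      · simpa [straighten, List.cons_le_cons_iff_of_linearOrder] using ih (h.restrict c) t
      · rw [h.cons_iff_singleton hcd]
        have htot := h.total [false] [true]
        have hanti := h.antisymm [false] [true]
        by_cases hL : L [false] [true] <;> cases c <;> cases d <;>
          simp_all [straighten, List.cons_le_cons_iff_of_linearOrder]

namespace List

variable {α : Type*} [LinearOrder α]

theorem lt_append_singleton (l : List α) (a : α) : l < l ++ [a] := by
  induction l with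
  | nil => simp
  | cons b l ih => simpa [List.cons_lt_cons_iff] using ih

theorem exists_between_of_lt [NoMinOrder α] (l₁ l₂ : List α) (h : l₁ < l₂) :
    ∃ l, l₁ < l ∧ l < l₂ := by
  induction l₁ generalizing l₂ with
  | nil =>
    cases l₂ with
    | nil => simp at h
    | cons b l₂ =>
      obtain ⟨a, ha⟩ := exists_lt b
      exact ⟨[a], by simp, by simp [List.cons_lt_cons_iff, ha]⟩
  | cons a l₁ ih =>
    cases l₂ with
    | nil => simp at h
    | cons b l₂ =>
      rcases List.cons_lt_cons_iff.1 h with hab | ⟨rfl, hl⟩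
      · exact ⟨(a :: l₁) ++ [a], lt_append_singleton _ _, by simp [List.cons_lt_cons_iff, hab]⟩
      · obtain ⟨l, h₁, h₂⟩ := ih l₂ hl
        exact ⟨a :: l, by simpa [List.cons_lt_cons_iff] using h₁,
          by simpa [List.cons_lt_cons_iff] using h₂⟩

instance [NoMinOrder α] : DenselyOrdered (List α) := ⟨exists_between_of_lt⟩

instance [Nonempty α] : NoMaxOrder (List α) :=
  ⟨fun l => ⟨_, lt_append_singleton l (Classical.arbitrary α)⟩⟩

/-- The lexicographic order on lists over a countable chain without least element has order
type `1 + η`. -/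
theorem exists_strictMono_surjective_of_countable [Countable α] [Nonempty α] [NoMinOrder α] :
    ∃ f : _root_.Lex (PUnit ⊕ ℚ) → List α, StrictMono f ∧ Function.Surjective f := by
  obtain ⟨g⟩ := Order.iso_of_countable_dense ℚ (Set.Ioi ([] : List α))
  refine ⟨fun x => Sum.elim (fun _ => []) (fun q => (g q : List α)) (ofLex x), ?_, ?_⟩
  · intro x y hxy
    rcases Sum.Lex.lt_def.1 hxy with h | h | _
    · exact absurd h (lt_irrefl _)
    · exact g.strictMono h
    · exact (g _).2
  · intro l
    by_cases hl : l = []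
    · exact ⟨toLex (Sum.inl PUnit.unit), by simp [hl]⟩
    · obtain ⟨q, hq⟩ := g.surjective ⟨l, by cases l <;> simp_all⟩
      exact ⟨toLex (Sum.inr q), by simp [hq]⟩

end List

/-- The word `0^n₁ 1 0^n₂ 1 ⋯ 0^nᵣ 1 0^k` encoded by `([n₁, …, nᵣ], k)`. -/
def runWord : List ℕᵒᵈ → ℕ → List Bool
  | [], k => List.replicate k false
  | n :: l, k => List.replicate (OrderDual.ofDual n) false ++ true :: runWord l k

theorem runWord_surjective (w : List Bool) : ∃ l k, runWord l k = w := by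
  induction w with
  | nil => exact ⟨[], 0, rfl⟩
  | cons b w ih =>
    obtain ⟨l, k, rfl⟩ := ih
    cases b
    · cases l with
      | nil => exact ⟨[], k + 1, rfl⟩
      | cons n l => exact ⟨OrderDual.toDual (OrderDual.ofDual n + 1) :: l, k, rfl⟩
    · exact ⟨OrderDual.toDual 0 :: l, k, rfl⟩

theorem replicate_false_lt (k n : ℕ) (w : List Bool) :
    List.replicate k false < List.replicate n false ++ true :: w := by
  induction k generalizing n with
  | zero => cases n <;> simp [List.replicate_succ]
  | succ k ih => cases n <;> simp [List.replicate_succ, List.cons_lt_cons_iff, ih]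

theorem replicate_false_append_lt {m n : ℕ} (hmn : n < m) (v w : List Bool) :
    List.replicate m false ++ v < List.replicate n false ++ true :: w := by
  induction m generalizing n with
  | zero => simp at hmn
  | succ m ih =>
    cases n with
    | zero => simp [List.replicate_succ, List.cons_lt_cons_iff]
    | succ n => simpa [List.replicate_succ, List.cons_lt_cons_iff] using ih (by omega)

theorem replicate_append_lt_iff (n : ℕ) (v w : List Bool) :
    List.replicate n false ++ v < List.replicate n false ++ w ↔ v < w := by
  induction n with
  | zero => simp
  | succ n ih => simpa [List.replicate_succ, List.cons_lt_cons_iff] using ih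

theorem runWord_lt_of_lt (l₁ l₂ : List ℕᵒᵈ) (h : l₁ < l₂) (j k : ℕ) :
    runWord l₁ j < runWord l₂ k := by
  induction l₁ generalizing l₂ with
  | nil =>
    cases l₂ with
    | nil => simp at h
    | cons n l₂ => exact replicate_false_lt _ _ _
  | cons m l₁ ih =>
    cases l₂ with
    | nil => simp at h
    | cons n l₂ =>
      rcases List.cons_lt_cons_iff.1 h with hmn | ⟨rfl, hl⟩
      · exact replicate_false_append_lt hmn _ _
      · rw [runWord, runWord, replicate_append_lt_iff, List.cons_lt_cons_iff]
        exact Or.inr ⟨rfl, ih l₂ hl⟩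

theorem runWord_strictMono (l : List ℕᵒᵈ) : StrictMono (runWord l) := by
  refine strictMono_nat_of_lt_succ fun k => ?_
  induction l with
  | nil => simpa [runWord, List.replicate_succ'] using List.lt_append_singleton _ _
  | cons n l ih =>
    rw [runWord, runWord, replicate_append_lt_iff, List.cons_lt_cons_iff]
    exact Or.inr ⟨rfl, ih⟩

/-- The lexicographic order on binary words has order type `ω·(1 + η)`. -/
theorem nonempty_orderIso_list_bool :
    Nonempty (Lex (Lex (PUnit ⊕ ℚ) × ℕ) ≃o List Bool) := by
  obtain ⟨f, hf, hfs⟩ := List.exists_strictMono_surjective_of_countable (α := ℕᵒᵈ)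
  refine ⟨StrictMono.orderIsoOfSurjective
    (fun p => runWord (f (ofLex p).1) (ofLex p).2) ?_ ?_⟩
  · intro p q hpq
    rcases Prod.Lex.lt_iff.1 hpq with h | ⟨h₁, h₂⟩
    · exact runWord_lt_of_lt _ _ (hf h) _ _
    · simpa only [h₁] using runWord_strictMono _ h₂
  · intro w
    obtain ⟨l, k, rfl⟩ := runWord_surjective w
    obtain ⟨x, rfl⟩ := hfs l
    exact ⟨toLex (x, k), rfl⟩


/-- Every non-separating linear extension of the binary tree `T₂ = (List Bool, <+:)`
has order type `ω·(1 + η)`, i.e. is isomorphic to the lexicographic product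
`(PUnit ⊕ₗ ℚ) ×ₗ ℕ`. -/
theorem nonseparating_extension_of_binary_tree_has_type_omega_one_add_eta
    (L : List Bool → List Bool → Prop)
    (hlin : IsLinearOrder (List Bool) L)
    (hext : ∀ l l' : List Bool, l <+: l' → L l l')
    (hns : ¬ ∃ x y z : List Bool,
        (x <+: z ∧ x ≠ z) ∧
        (¬ y <+: x ∧ ¬ x <+: y) ∧ (¬ y <+: z ∧ ¬ z <+: y) ∧
        L x y ∧ L y z ∧ y ≠ x ∧ y ≠ z) :
    ∃ e : List Bool ≃ Lex ((Lex (PUnit ⊕ ℚ)) × ℕ),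
      ∀ a b : List Bool, L a b ↔ e a ≤ e b := by
  have h : IsNonseparatingExtension L :=
    ⟨hlin.trans, hlin.antisymm, hlin.total, hext, fun x y z hxz hne h₁ h₂ h₃ h₄ hxy hyz =>
      hns ⟨x, y, z, ⟨hxz, hne⟩, ⟨h₁, h₂⟩, ⟨h₃, h₄⟩, hxy, hyz,
        fun e => h₁ (e ▸ List.prefix_rfl), fun e => h₃ (e ▸ List.prefix_rfl)⟩⟩
  have hinj : Function.Injective (straighten L) := fun a b hab =>
    h.antisymm _ _ ((h.iff_straighten_le a b).2 hab.le) ((h.iff_straighten_le b a).2 hab.ge)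
  obtain ⟨g⟩ := nonempty_orderIso_list_bool
  exact ⟨(Equiv.ofBijective _ ⟨hinj, straighten_surjective L⟩).trans g.symm.toEquiv,
    fun a b => (h.iff_straighten_le a b).trans (g.symm.le_iff_le).symm⟩
end

section
/- Let P be a poset such that: there is no order embedding of ℚ into P; and for every injective e : ℚ → ℕ there is no map f : ℚ → P with f q ≤ f q' ↔ (q ≤ q' and e q ≤ e q'), and no map g : ℚ → P with g q ≤ g q' ↔ (q' ≤ q and e q' ≤ e q) (neither η, Ω(η), nor the dual of Ω(η) embeds into P). Then for every linear order L on P extending ≤ and every map f : ℚ → P such that for all q, q', q ≤ q' ↔ L (f q) (f q') and f is injective, there exists an injective map h : ℚ → P whose range is contained in the range of f, whose values are pairwise incomparable in P, and such that q ≤ q' ↔ L (h q) (h q') for all q, q'. -/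
/-- A set of rationals is `Large` if it contains a copy of `ℚ`. -/
def Large (S : Set ℚ) : Prop := ∃ g : ℚ → ℚ, StrictMono g ∧ ∀ q, g q ∈ S

theorem Large.mono {S T : Set ℚ} (hS : Large S) (h : S ⊆ T) : Large T :=
  let ⟨g, hg, hgS⟩ := hS
  ⟨g, hg, fun q => h (hgS q)⟩

theorem Large.nonempty {S : Set ℚ} (hS : Large S) : S.Nonempty :=
  let ⟨g, _, hgS⟩ := hS
  ⟨g 0, hgS 0⟩

theorem not_large_empty : ¬ Large ∅ := fun h => h.nonempty.ne_empty rfl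

theorem large_of_dense {T : Set ℚ} (h : ∀ a b : ℚ, a < b → ∃ t ∈ T, a < t ∧ t < b) :
    Large T := by
  have : DenselyOrdered T := ⟨fun a b hab => by
    obtain ⟨t, ht, h1, h2⟩ := h a b hab
    exact ⟨⟨t, ht⟩, h1, h2⟩⟩
  have : NoMinOrder T := ⟨fun a => by
    obtain ⟨t, ht, -, h2⟩ := h (a - 1) a (by linarith)
    exact ⟨⟨t, ht⟩, h2⟩⟩
  have : NoMaxOrder T := ⟨fun a => by
    obtain ⟨t, ht, h1, -⟩ := h a (a + 1) (by linarith)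
    exact ⟨⟨t, ht⟩, h1⟩⟩
  have : Nonempty T := by
    obtain ⟨t, ht, -⟩ := h 0 1 (by norm_num)
    exact ⟨⟨t, ht⟩⟩
  obtain ⟨i⟩ := Order.iso_of_countable_dense ℚ T
  exact ⟨fun q => i q, fun a b hab => i.strictMono hab, fun q => (i q).2⟩

theorem large_Ioo {a b : ℚ} (hab : a < b) : Large (Set.Ioo a b) := by
  have : Nonempty (Set.Ioo a b) := Set.nonempty_Ioo_subtype hab
  obtain ⟨i⟩ := Order.iso_of_countable_dense ℚ (Set.Ioo a b)
  exact ⟨fun q => i q, fun a b hab => i.strictMono hab, fun q => (i q).2⟩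

theorem Large.of_preimage {S : Set ℚ} {g : ℚ → ℚ} (hg : StrictMono g)
    (h : Large (g ⁻¹' S)) : Large S :=
  let ⟨k, hk, hkS⟩ := h
  ⟨g ∘ k, hg.comp hk, hkS⟩

theorem Large.or_of_union {S T : Set ℚ} (h : Large (S ∪ T)) : Large S ∨ Large T := by
  obtain ⟨g, hg, hgS⟩ := h
  by_cases hd : ∀ a b : ℚ, a < b → ∃ t ∈ g ⁻¹' S, a < t ∧ t < b
  · exact .inl (.of_preimage hg (large_of_dense hd))
  · push Not at hd
    obtain ⟨a, b, hab, hd⟩ := hd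
    refine .inr (.of_preimage hg ((large_Ioo hab).mono fun t ht => ?_))
    exact (hgS t).resolve_left fun hS => absurd ht.2 (not_lt.2 (hd t hS ht.1))

theorem Large.split {S : Set ℚ} (h : Large S) :
    ∃ A ⊆ S, ∃ B ⊆ S, Large A ∧ Large B ∧ ∀ a ∈ A, ∀ b ∈ B, a < b := by
  obtain ⟨g, hg, hgS⟩ := h
  have key : ∀ a b : ℚ, a < b → Large (g '' Set.Ioo a b) := fun a b hab =>
    .of_preimage hg ((large_Ioo hab).mono (Set.subset_preimage_image _ _))
  refine ⟨g '' Set.Ioo 0 1, ?_, g '' Set.Ioo 1 2, ?_, key _ _ (by norm_num),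
    key _ _ (by norm_num), ?_⟩
  · rintro _ ⟨q, -, rfl⟩; exact hgS q
  · rintro _ ⟨q, -, rfl⟩; exact hgS q
  · rintro _ ⟨a, ha, rfl⟩ _ ⟨b, hb, rfl⟩
    exact hg (ha.2.trans hb.1)

theorem not_large_biUnion {ι : Type*} {s : Set ι} (hs : s.Finite) {Z : ι → Set ℚ}
    (h : ∀ i ∈ s, ¬ Large (Z i)) : ¬ Large (⋃ i ∈ s, Z i) := by
  induction s, hs using Set.Finite.induction_on with
  | empty => simpa using not_large_empty
  | insert _ _ ih =>
    rw [Set.biUnion_insert]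
    intro hl
    rcases hl.or_of_union with hl | hl
    · exact h _ (Set.mem_insert _ _) hl
    · exact ih (fun i hi => h i (Set.mem_insert_of_mem _ hi)) hl

/-- For every large `B' ⊆ B`, all but a non-large set of `a ∈ A` are joined in colour `c`
to a large part of `B'`. -/
def Dominates (R : ℚ → ℚ → Prop) (c : Bool) (A B : Set ℚ) : Prop :=
  ∀ B' ⊆ B, Large B' → ¬ Large {a ∈ A | ¬ Large {b ∈ B' | R a b ↔ c = true}}

theorem Dominates.mono {R : ℚ → ℚ → Prop} {c : Bool} {A A' B B' : Set ℚ}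
    (h : Dominates R c A B) (hA : A' ⊆ A) (hB : B' ⊆ B) : Dominates R c A' B' :=
  fun C hC hCl hl => h C (hC.trans hB) hCl (hl.mono fun _ ha => ⟨hA ha.1, ha.2⟩)

theorem exists_dominates (R : ℚ → ℚ → Prop) {A B : Set ℚ} (hA : Large A) (hB : Large B) :
    ∃ c, ∃ A' ⊆ A, ∃ B' ⊆ B, Large A' ∧ Large B' ∧ Dominates R c A' B' := by
  by_cases h : Dominates R true A B
  · exact ⟨true, A, subset_rfl, B, subset_rfl, hA, hB, h⟩
  · unfold Dominates at h
    push Not at h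
    obtain ⟨B', hB', hBl, hl⟩ := h
    refine ⟨false, _, Set.sep_subset _ _, B', hB', hl, hBl, fun C hC hCl hl' => ?_⟩
    obtain ⟨a, ⟨-, ha⟩, ha'⟩ := hl'.nonempty
    have hu : Large ({b ∈ C | R a b ↔ true = true} ∪ {b ∈ C | R a b ↔ false = true}) :=
      hCl.mono fun b hb => by
        by_cases hr : R a b
        · exact .inl ⟨hb, by simpa using hr⟩
        · exact .inr ⟨hb, by simpa using hr⟩
    rcases hu.or_of_union with hu | hu
    · exact ha (hu.mono fun b hb => ⟨hC hb.1, hb.2⟩)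
    · exact ha' hu

/-- `A` lies to the left of `B`, and the pair dominates in both directions. -/
structure Decided (R : ℚ → ℚ → Prop) (c d : Bool) (A B : Set ℚ) : Prop where
  lt : ∀ a ∈ A, ∀ b ∈ B, a < b
  right : Dominates R c A B
  left : Dominates (fun x y => R y x) d B A

theorem Decided.mono {R : ℚ → ℚ → Prop} {c d : Bool} {A A' B B' : Set ℚ}
    (h : Decided R c d A B) (hA : A' ⊆ A) (hB : B' ⊆ B) : Decided R c d A' B' :=
  ⟨fun a ha b hb => h.lt a (hA ha) b (hB hb), h.right.mono hA hB, h.left.mono hB hA⟩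

theorem exists_decided (R : ℚ → ℚ → Prop) {S : Set ℚ} (hS : Large S) :
    ∃ c d, ∃ A ⊆ S, ∃ B ⊆ S, Large A ∧ Large B ∧ Decided R c d A B := by
  obtain ⟨A, hA, B, hB, hAl, hBl, hlt⟩ := hS.split
  obtain ⟨c, A₁, hA₁, B₁, hB₁, hAl₁, hBl₁, hc⟩ := exists_dominates R hAl hBl
  obtain ⟨d, B₂, hB₂, A₂, hA₂, hBl₂, hAl₂, hd⟩ :=
    exists_dominates (fun x y => R y x) hBl₁ hAl₁
  exact ⟨c, d, A₂, hA₂.trans (hA₁.trans hA), B₂, hB₂.trans (hB₁.trans hB), hAl₂, hBl₂,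
    fun a ha b hb => hlt a (hA₁ (hA₂ ha)) b (hB₁ (hB₂ hb)), hc.mono hA₂ hB₂, hd⟩

theorem exists_uniformly_decided (R : ℚ → ℚ → Prop) :
    ∃ c d, ∃ X, Large X ∧ ∀ Y ⊆ X, Large Y →
      ∃ A ⊆ Y, ∃ B ⊆ Y, Large A ∧ Large B ∧ Decided R c d A B := by
  by_contra! H
  obtain ⟨Y₁, -, l₁, H₁⟩ := H true true Set.univ ⟨id, strictMono_id, fun _ => trivial⟩
  obtain ⟨Y₂, s₂, l₂, H₂⟩ := H true false Y₁ l₁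
  obtain ⟨Y₃, s₃, l₃, H₃⟩ := H false true Y₂ l₂
  obtain ⟨Y₄, s₄, l₄, H₄⟩ := H false false Y₃ l₃
  obtain ⟨c, d, A, hA, B, hB, hAl, hBl, h⟩ := exists_decided R l₄
  have h₃ := s₄
  have h₂ := h₃.trans s₃
  have h₁ := h₂.trans s₂
  cases c <;> cases d
  · exact H₄ A hA B hB hAl hBl h
  · exact H₃ A (hA.trans h₃) B (hB.trans h₃) hAl hBl h
  · exact H₂ A (hA.trans h₂) B (hB.trans h₂) hAl hBl h
  · exact H₁ A (hA.trans h₁) B (hB.trans h₁) hAl hBl h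

/-- The reservoirs `Y q` from which the images of the rationals `q` not treated in the
first `n` steps will be chosen. -/
structure IsReservoir (R : ℚ → ℚ → Prop) (c d : Bool) (X : Set ℚ) (e : ℚ → ℕ) (n : ℕ)
    (Y : ℚ → Set ℚ) : Prop where
  finite : (Set.range Y).Finite
  subset : ∀ q, n ≤ e q → Y q ⊆ X
  large : ∀ q, n ≤ e q → Large (Y q)
  decided : ∀ p q, n ≤ e p → n ≤ e q → p < q → Y p = Y q ∨ Decided R c d (Y p) (Y q)

open Classical in
theorem IsReservoir.step {R : ℚ → ℚ → Prop} {c d : Bool} {X : Set ℚ} {e : ℚ → ℕ}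
    (hX : ∀ Y ⊆ X, Large Y → ∃ A ⊆ Y, ∃ B ⊆ Y, Large A ∧ Large B ∧ Decided R c d A B)
    {n : ℕ} {Y : ℚ → Set ℚ} (hY : IsReservoir R c d X e n Y) {p : ℚ} (hp : e p = n) :
    ∃ x ∈ Y p, ∃ Y' : ℚ → Set ℚ, IsReservoir R c d X e (n + 1) Y' ∧
      ∀ q, n + 1 ≤ e q → Y' q ⊆ Y q ∧
        (p < q → ∀ t ∈ Y' q, x < t ∧ (R x t ↔ c = true)) ∧
        (q < p → ∀ t ∈ Y' q, t < x ∧ (R t x ↔ d = true)) := by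
  obtain ⟨A, hA, B, hB, hAl, hBl, hAB⟩ := hX _ (hY.subset p hp.ge) (hY.large p hp.ge)
  obtain ⟨C, hC, D, hD, hCl, hDl, hCD⟩ := hX _ (hB.trans (hY.subset p hp.ge)) hBl
  -- The sets that the new point has to be compared with.
  let Z : ℚ → Set ℚ := fun q => if Y q = Y p then (if q < p then A else D) else Y q
  have hZY : ∀ q, Z q ⊆ Y q := fun q => by
    dsimp only [Z]
    split_ifs with h1 h2
    · exact h1 ▸ hA
    · exact h1 ▸ hD.trans hB
    · exact subset_rfl
  have hZl : ∀ q, n ≤ e q → Large (Z q) := fun q hq => by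
    dsimp only [Z]
    split_ifs with h1 h2
    · exact hAl
    · exact hDl
    · exact hY.large q hq
  have hZfin : (Set.range Z).Finite := by
    refine (hY.finite.union (Set.toFinite {A, D})).subset ?_
    rintro _ ⟨q, rfl⟩
    dsimp only [Z]
    split_ifs
    · simp
    · simp
    · simp
  have hne : ∀ q, n + 1 ≤ e q → q ≠ p := by rintro q hq rfl; omega
  have hZr : ∀ q, n + 1 ≤ e q → p < q → Decided R c d C (Z q) := fun q hq hpq => by
    dsimp only [Z]
    split_ifs with h1 h2
    · exact absurd hpq h2.not_gt
    · exact hCD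
    · rcases hY.decided p q hp.ge (by omega) hpq with h | h
      · exact absurd h.symm h1
      · exact h.mono (hC.trans hB) subset_rfl
  have hZL : ∀ q, n + 1 ≤ e q → q < p → Decided R c d (Z q) C := fun q hq hqp => by
    dsimp only [Z]
    split_ifs with h1
    · exact hAB.mono subset_rfl hC
    · rcases hY.decided q p (by omega) hp.ge hqp with h | h
      · exact absurd h h1
      · exact h.mono subset_rfl (hC.trans hB)
  have hZd : ∀ q r, n + 1 ≤ e q → n + 1 ≤ e r → q < r →
      (Z q = Z r ∧ (q < p ↔ r < p)) ∨ Decided R c d (Z q) (Z r) := fun q r hq hr hqr => by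
    rcases hY.decided q r (by omega) (by omega) hqr with h | h
    · by_cases hs : q < p ↔ r < p
      · left
        refine ⟨?_, hs⟩
        simp only [Z, h, hs]
      · right
        have hrp : p < r := by
          rcases lt_trichotomy r p with h | h | h
          · exact absurd ⟨fun _ => h, fun _ => hqr.trans h⟩ hs
          · exact absurd h (hne r hr)
          · exact h
        have hqp : q < p := by
          by_contra hqp
          exact hs ⟨fun h => absurd h hqp, fun h => absurd h hrp.not_gt⟩
        by_cases hqY : Y q = Y p
        · have hrY : Y r = Y p := h ▸ hqY
          simp only [Z, hqY, hrY, hqp, hrp.not_gt, if_true, if_false]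
          exact hAB.mono subset_rfl hD
        · exfalso
          have h1 := (hY.decided q p (by omega) hp.ge hqp).resolve_left hqY
          have h2 := (hY.decided p r hp.ge (by omega) hrp).resolve_left
            (fun h' => hqY (h.trans h'.symm))
          obtain ⟨a, ha⟩ := (hY.large q (by omega)).nonempty
          obtain ⟨b, hb⟩ := (hY.large p hp.ge).nonempty
          exact lt_asymm (h1.lt a ha b hb) (h2.lt b hb a (h ▸ ha))
    · exact .inr (h.mono (hZY q) (hZY r))
  -- A point of `C` generic for all the sets `Z q`.
  obtain ⟨x, hxC, hxr, hxl⟩ : ∃ x ∈ C,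
      (∀ q, n + 1 ≤ e q → p < q → Large {t ∈ Z q | R x t ↔ c = true}) ∧
      (∀ q, n + 1 ≤ e q → q < p → Large {t ∈ Z q | R t x ↔ d = true}) := by
    let S₁ : Set (Set ℚ) := Z '' {q | n + 1 ≤ e q ∧ p < q}
    let S₂ : Set (Set ℚ) := Z '' {q | n + 1 ≤ e q ∧ q < p}
    have n₁ : ¬ Large (⋃ W ∈ S₁, {a ∈ C | ¬ Large {b ∈ W | R a b ↔ c = true}}) := by
      refine not_large_biUnion (hZfin.subset (Set.image_subset_range _ _)) ?_
      rintro _ ⟨q, ⟨hq, hpq⟩, rfl⟩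
      exact (hZr q hq hpq).right _ subset_rfl (hZl q (by omega))
    have n₂ : ¬ Large (⋃ W ∈ S₂, {a ∈ C | ¬ Large {b ∈ W | R b a ↔ d = true}}) := by
      refine not_large_biUnion (hZfin.subset (Set.image_subset_range _ _)) ?_
      rintro _ ⟨q, ⟨hq, hpq⟩, rfl⟩
      exact (hZL q hq hpq).left _ subset_rfl (hZl q (by omega))
    by_contra! H
    refine (Large.or_of_union (hCl.mono fun x hx => ?_)).elim n₁ n₂
    by_cases hx₁ : ∀ q, n + 1 ≤ e q → p < q → Large {t ∈ Z q | R x t ↔ c = true}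
    · obtain ⟨q, hq, hqp, hl⟩ := H x hx hx₁
      exact .inr (Set.mem_biUnion (Set.mem_image_of_mem Z ⟨hq, hqp⟩) ⟨hx, hl⟩)
    · push Not at hx₁
      obtain ⟨q, hq, hqp, hl⟩ := hx₁
      exact .inl (Set.mem_biUnion (Set.mem_image_of_mem Z ⟨hq, hqp⟩) ⟨hx, hl⟩)
  let Y' : ℚ → Set ℚ := fun q =>
    if q < p then {t ∈ Z q | R t x ↔ d = true} else {t ∈ Z q | R x t ↔ c = true}
  have hY'Z : ∀ q, Y' q ⊆ Z q := fun q => by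
    dsimp only [Y']
    split_ifs <;> exact Set.sep_subset _ _
  refine ⟨x, hB (hC hxC), Y', ⟨?_, ?_, ?_, ?_⟩, fun q hq => ⟨(hY'Z q).trans (hZY q), ?_, ?_⟩⟩
  · refine ((hZfin.image fun W => {t ∈ W | R t x ↔ d = true}).union
      (hZfin.image fun W => {t ∈ W | R x t ↔ c = true})).subset ?_
    rintro _ ⟨q, rfl⟩
    dsimp only [Y']
    split_ifs
    · exact .inl ⟨_, ⟨q, rfl⟩, rfl⟩
    · exact .inr ⟨_, ⟨q, rfl⟩, rfl⟩
  · exact fun q hq => ((hY'Z q).trans (hZY q)).trans (hY.subset q (by omega))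
  · intro q hq
    dsimp only [Y']
    split_ifs with h
    · exact hxl q hq h
    · exact hxr q hq (lt_of_le_of_ne (not_lt.1 h) (hne q hq).symm)
  · intro q r hq hr hqr
    rcases hZd q r hq hr hqr with ⟨h, hs⟩ | h
    · left
      simp only [Y', h, hs]
    · exact .inr (h.mono (hY'Z q) (hY'Z r))
  · intro hpq t ht
    refine ⟨(hZr q hq hpq).lt x hxC t (hY'Z q ht), ?_⟩
    simp only [Y', hpq.not_gt, if_false] at ht
    exact ht.2
  · intro hqp t ht
    refine ⟨(hZL q hq hqp).lt t (hY'Z q ht) x hxC, ?_⟩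
    simp only [Y', hqp, if_true] at ht
    exact ht.2

/-- **Galvin's theorem** for two colours: any binary relation on `ℚ` becomes canonical with
respect to an enumeration `e` on some copy of `ℚ`. -/
theorem exists_strictMono_canonical (R : ℚ → ℚ → Prop) (e : ℚ ≃ ℕ) :
    ∃ (c d : Bool) (h : ℚ → ℚ), StrictMono h ∧
      (∀ p q, p < q → e p < e q → (R (h p) (h q) ↔ c = true)) ∧
      (∀ p q, p < q → e q < e p → (R (h p) (h q) ↔ d = true)) := by
  obtain ⟨c, d, X, hXl, hX⟩ := exists_uniformly_decided R
  have step := fun (n : ℕ) (Y : {Y // IsReservoir R c d X e n Y}) =>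
    Y.2.step hX (e.apply_symm_apply n)
  choose x hx Y' hY' hsub using step
  let Y : ∀ n, {Y // IsReservoir R c d X e n Y} := fun n =>
    Nat.rec ⟨fun _ => X, ⟨Set.finite_range_const, fun _ _ => subset_rfl, fun _ _ => hXl,
      fun _ _ _ _ _ => .inl rfl⟩⟩ (fun n Y => ⟨Y' n Y, hY' n Y⟩) n
  have hanti : ∀ (q : ℚ) (m n : ℕ), m ≤ n → n ≤ e q → (Y n).1 q ⊆ (Y m).1 q := by
    intro q m n hmn
    induction n, hmn using Nat.le_induction with
    | base => exact fun _ => subset_rfl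
    | succ n _ ih => exact fun hq => ((hsub n (Y n) q hq).1).trans (ih (by omega))
  let h : ℚ → ℚ := fun q => x (e q) (Y (e q))
  have hmem : ∀ p q, e p < e q → h q ∈ (Y (e p + 1)).1 q := fun p q hpq => by
    have h1 := hx (e q) (Y (e q))
    rw [e.symm_apply_apply] at h1
    exact hanti q _ _ hpq le_rfl h1
  have hright : ∀ p q, p < q → e p < e q → h p < h q ∧ (R (h p) (h q) ↔ c = true) :=
    fun p q hpq hepq => (hsub (e p) (Y (e p)) q hepq).2.1
      (by rwa [e.symm_apply_apply]) _ (hmem p q hepq)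
  have hleft : ∀ p q, p < q → e q < e p → h p < h q ∧ (R (h p) (h q) ↔ d = true) :=
    fun p q hpq hepq => (hsub (e q) (Y (e q)) p hepq).2.2
      (by rwa [e.symm_apply_apply]) _ (hmem q p hepq)
  refine ⟨c, d, h, fun p q hpq => ?_, fun p q h1 h2 => (hright p q h1 h2).2,
    fun p q h1 h2 => (hleft p q h1 h2).2⟩
  rcases lt_or_gt_of_ne (e.injective.ne hpq.ne) with hlt | hgt
  · exact (hright p q hpq hlt).1
  · exact (hleft p q hpq hgt).1

/-- If neither `η`, `Ω(η)` nor the dual of `Ω(η)` embeds into a poset `P`, then for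
every linear extension `L` of `P` and every copy of `η` in `L` (given by an injective
`f : ℚ → P` with `q ≤ q' ↔ L (f q) (f q')`), there is a copy of `η` in `L` inside the
range of `f` which is an antichain of `P`. -/
theorem antichain_eta_of_no_eta_no_omega_eta
    {α : Type*} [PartialOrder α]
    (hη : ¬ ∃ f : ℚ → α, ∀ q q' : ℚ, q ≤ q' ↔ f q ≤ f q')
    (hΩ : ∀ e : ℚ → ℕ, Function.Injective e →
      (¬ ∃ f : ℚ → α, ∀ q q' : ℚ, f q ≤ f q' ↔ (q ≤ q' ∧ e q ≤ e q')) ∧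
      (¬ ∃ g : ℚ → α, ∀ q q' : ℚ, g q ≤ g q' ↔ (q' ≤ q ∧ e q' ≤ e q))) :
    ∀ L : α → α → Prop, IsLinearOrder α L → (∀ a b : α, a ≤ b → L a b) →
      ∀ f : ℚ → α, Function.Injective f → (∀ q q' : ℚ, q ≤ q' ↔ L (f q) (f q')) →
        ∃ h : ℚ → α, Function.Injective h ∧
          Set.range h ⊆ Set.range f ∧
          (∀ q q' : ℚ, q ≠ q' → ¬ h q ≤ h q') ∧
          (∀ q q' : ℚ, q ≤ q' ↔ L (h q) (h q')) := by
  intro L _ hext f hf hfL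
  let e : ℚ ≃ ℕ := Denumerable.eqv ℚ
  obtain ⟨c, d, h, hh, hc, hd⟩ := exists_strictMono_canonical (fun x y => f x ≤ f y) e
  have hle : ∀ p q, f (h p) ≤ f (h q) → p ≤ q := fun p q hpq =>
    hh.le_iff_le.1 ((hfL _ _).2 (hext _ _ hpq))
  have hiff : ∀ p q, f (h p) ≤ f (h q) ↔
      p = q ∨ p < q ∧ (e p < e q ∧ c = true ∨ e q < e p ∧ d = true) := by
    intro p q
    rcases lt_trichotomy p q with hpq | rfl | hpq
    · rcases lt_or_gt_of_ne (e.injective.ne hpq.ne) with h' | h'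
      · simp [hc p q hpq h', hpq, hpq.ne, h', h'.not_gt]
      · simp [hd p q hpq h', hpq, hpq.ne, h', h'.not_gt]
    · simp
    · simp only [hpq.ne', hpq.not_gt, false_and, or_self, iff_false]
      exact fun h' => absurd (hle p q h') hpq.not_ge
  have hcases : ∀ p q, p = q ∨ e p < e q ∨ e q < e p := fun p q => by
    rcases lt_trichotomy (e p) (e q) with h' | h' | h'
    · exact .inr (.inl h')
    · exact .inl (e.injective h')
    · exact .inr (.inr h')
  have hΩiff : ∀ p q : ℚ, (p ≤ q ∧ e p ≤ e q) ↔ p = q ∨ p < q ∧ e p < e q := fun p q => by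
    constructor
    · rintro ⟨h1, h2⟩
      rcases h1.eq_or_lt with h1 | h1
      · exact .inl h1
      · exact .inr ⟨h1, lt_of_le_of_ne h2 (e.injective.ne h1.ne)⟩
    · rintro (rfl | ⟨h1, h2⟩)
      · exact ⟨le_rfl, le_rfl⟩
      · exact ⟨h1.le, h2.le⟩
  cases c <;> cases d
  · refine ⟨f ∘ h, hf.comp hh.injective, Set.range_comp_subset_range h f, ?_, ?_⟩
    · intro p q hpq
      simp [hiff, hpq]
    · intro p q
      rw [← hh.le_iff_le]
      exact hfL _ _
  · refine absurd ⟨fun q => f (h (-q)), fun p q => ?_⟩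
      (hΩ (fun q => e (-q)) (e.injective.comp neg_injective)).2
    rw [hiff]
    simp only [neg_inj, neg_lt_neg_iff, Bool.false_eq_true, and_false, and_true, false_or]
    constructor
    · rintro (rfl | ⟨h1, h2⟩)
      · exact ⟨le_rfl, le_rfl⟩
      · exact ⟨h1.le, h2.le⟩
    · rintro ⟨h1, h2⟩
      rcases h1.eq_or_lt with h1 | h1
      · exact .inl h1.symm
      · exact .inr ⟨h1, lt_of_le_of_ne h2 (e.injective.ne (neg_injective.ne h1.ne))⟩
  · refine absurd ⟨f ∘ h, fun p q => ?_⟩ (hΩ e e.injective).1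
    simp [hiff, hΩiff]
  · refine absurd ⟨f ∘ h, fun p q => ?_⟩ hη
    refine ⟨fun hpq => (hiff p q).2 ?_, hle p q⟩
    rcases hpq.eq_or_lt with h1 | h1
    · exact .inl h1
    · exact .inr ⟨h1, by simpa using (hcases p q).resolve_left h1.ne⟩
end
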